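/- arXiv:math/0701721 — 7 statements merged into one kernel-verified Lean document; each statement's English description precedes it below -/
import Mathlib

section
/- Let 0 ≤ d ≤ m+n, 0 ≤ p ≤ m, and q := d−p. If 0 ≤ q ≤ n, then u_{d,p}(x) = (−1)^{q(m−p)} · V(A) · V(B) · Sylv^{p,q}(A,B;x) in K[x]. -/
open Polynomial Finset

variable {K : Type*} [Field K]

/-- Sylvester's double sum `Sylv^{p,q}(A,B;x)`. -/
noncomputable def sylvSum {m n : ℕ} (A : Fin m → K) (B : Fin n → K) (p q : ℕ) :
    Polynomial K :=
  ∑ Sa ∈ Finset.powersetCard p (Finset.univ : Finset (Fin m)),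
    ∑ Sb ∈ Finset.powersetCard q (Finset.univ : Finset (Fin n)),
      (∏ i ∈ Sa, (X - C (A i))) * (∏ j ∈ Sb, (X - C (B j))) *
        C (((∏ i ∈ Sa, ∏ j ∈ Sb, (A i - B j)) *
            (∏ i ∈ Saᶜ, ∏ j ∈ Sbᶜ, (A i - B j))) /
           ((∏ i ∈ Sa, ∏ i' ∈ Saᶜ, (A i - A i')) *
            (∏ j ∈ Sb, ∏ j' ∈ Sbᶜ, (B j - B j'))))

/-- The matrix whose determinant defines the `k`-th subresultant of `f` (of degree `m`) and
`g` (of degree `n`), with a general last column given by `wf` on the `f`-rows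
and `wg` on the `g`-rows. -/
noncomputable def sresMatGen (m n k : ℕ) (f g : Polynomial K) (wf wg : ℕ → Polynomial K) :
    Matrix (Fin ((n - k) + (m - k))) (Fin ((n - k) + (m - k))) (Polynomial K) :=
  Matrix.of fun r c =>
    if (r : ℕ) < n - k then
      if (c : ℕ) = (n - k) + (m - k) - 1 then wf (r : ℕ)
      else if (c : ℕ) ≤ m + (r : ℕ) then C (f.coeff (m + (r : ℕ) - (c : ℕ))) else 0
    else
      if (c : ℕ) = (n - k) + (m - k) - 1 then wg ((r : ℕ) - (n - k))
      else if (c : ℕ) ≤ n + ((r : ℕ) - (n - k)) then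
        C (g.coeff (n + ((r : ℕ) - (n - k)) - (c : ℕ)))
      else 0

/-- The `k`-th subresultant `Sres_k(f,g)`. -/
noncomputable def sres (m n k : ℕ) (f g : Polynomial K) : Polynomial K :=
  (sresMatGen m n k f g (fun i => X ^ (n - k - 1 - i) * f)
    (fun i => X ^ (m - k - 1 - i) * g)).det

/-- The polynomial `F_k`: the last column is replaced by `(x^{n-k-1},…,x^0,0,…,0)ᵀ`. -/
noncomputable def sresF (m n k : ℕ) (f g : Polynomial K) : Polynomial K :=
  (sresMatGen m n k f g (fun i => X ^ (n - k - 1 - i)) (fun _ => 0)).det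

/-- The polynomial `G_k`: the last column is replaced by `(0,…,0,x^{m-k-1},…,x^0)ᵀ`. -/
noncomputable def sresG (m n k : ℕ) (f g : Polynomial K) : Polynomial K :=
  (sresMatGen m n k f g (fun _ => 0) (fun i => X ^ (m - k - 1 - i))).det

/-- The `k`-th scalar subresultant `Δ_k(f,g)`, with the convention `Δ_m(f,g) = 1`
when `m = n`. -/
noncomputable def sresDelta (m n k : ℕ) (f g : Polynomial K) : K :=
  if m = n ∧ k = m then 1 else (sres m n k f g).coeff k

/-- The Vandermonde determinant `V(Γ)` of a list `Γ`. -/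
def vand {u : ℕ} (Γ : Fin u → K) : K :=
  ∏ i : Fin u, ∏ j ∈ Finset.Ioi i, (Γ j - Γ i)

/-- The matrix `U_d(x,T)`, viewed over `(K[x])[T]`: the outer variable `X` is `T`, and
the inner variable is `x`.  Its first `m+n-d` rows are `[⟨1,B⟩_{d'} | ⟨T,A⟩_{d'}]` and its
last `d` rows are `[⟨x-t,B⟩_d | ⟨x-t,A⟩_d]`. -/
noncomputable def sylvU {m n : ℕ} (A : Fin m → K) (B : Fin n → K) (d : ℕ) :
    Matrix (Fin (m + n)) (Fin (m + n)) (Polynomial (Polynomial K)) :=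
  Matrix.of fun r c =>
    if (r : ℕ) < m + n - d then
      if h : (c : ℕ) < n then C (C (B ⟨c, h⟩ ^ (r : ℕ)))
      else X * C (C (A ⟨(c : ℕ) - n, by have := c.isLt; omega⟩ ^ (r : ℕ)))
    else
      if h : (c : ℕ) < n then
        C ((C (B ⟨c, h⟩)) ^ ((r : ℕ) - (m + n - d)) * (X - C (B ⟨c, h⟩)))
      else
        C ((C (A ⟨(c : ℕ) - n, by have := c.isLt; omega⟩)) ^ ((r : ℕ) - (m + n - d)) *
           (X - C (A ⟨(c : ℕ) - n, by have := c.isLt; omega⟩)))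

/-- The `(m+n+1)`-square matrix over `K[T]` whose first `m+n-d` rows are
`[⟨1,B⟩_{d'} | ⟨T,A⟩_{d'} | 0]` and whose last `d+1` rows are
`[⟨1,B⟩_{d+1} | ⟨1,A⟩_{d+1} | e]`, where the last column vector `e` has a single
entry `1` in (0-based) position `e₀` of the bottom block. -/
noncomputable def sylvM {m n : ℕ} (A : Fin m → K) (B : Fin n → K) (d e₀ : ℕ) :
    Matrix (Fin (m + n + 1)) (Fin (m + n + 1)) (Polynomial K) :=
  Matrix.of fun r c =>
    if (r : ℕ) < m + n - d then
      if h : (c : ℕ) < n then C (B ⟨c, h⟩ ^ (r : ℕ))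
      else if h2 : (c : ℕ) < n + m then X * C (A ⟨(c : ℕ) - n, by omega⟩ ^ (r : ℕ))
      else 0
    else
      if h : (c : ℕ) < n then C (B ⟨c, h⟩ ^ ((r : ℕ) - (m + n - d)))
      else if h2 : (c : ℕ) < n + m then
        C (A ⟨(c : ℕ) - n, by omega⟩ ^ ((r : ℕ) - (m + n - d)))
      else if (r : ℕ) - (m + n - d) = e₀ then 1 else 0

section LaplaceExpansion

theorem card_filter_le_equiv {ι : Type*} [Fintype ι] {N : ℕ} (e : ι ≃ Fin N) (a : ℕ) :
    #{i | a ≤ (e i : ℕ)} = N - a := by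
  have h : #{i | a ≤ (e i : ℕ)} = #{k : Fin N | ¬ (k : ℕ) < a} := card_equiv e (by simp)
  have h₂ := card_filter_add_card_filter_not (s := (univ : Finset (Fin N)))
    (fun k => (k : ℕ) < a)
  rw [Fin.card_filter_val_lt, card_univ, Fintype.card_fin] at h₂
  omega

variable {R ι : Type*} [CommRing R] [Fintype ι] [DecidableEq ι]

/-- Laplace expansion along the rows satisfying `P`, the complementary minors being encoded
by masking the entries of the matrix. -/
theorem det_eq_sum_det_mask (P : ι → Prop) [DecidablePred P] (M : Matrix ι ι R) :
    M.det = ∑ S ∈ powersetCard #{i | P i} univ,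
      (Matrix.of fun i c => if P i ↔ c ∈ S then M i c else 0).det := by
  simp only [Matrix.det_apply', Matrix.of_apply]
  rw [sum_comm]
  refine sum_congr rfl fun σ _ => ?_
  have hmem : ({c | P (σ c)} : Finset ι) ∈ powersetCard #{i | P i} univ := by
    rw [mem_powersetCard]
    exact ⟨subset_univ _, card_equiv σ (by simp)⟩
  rw [sum_eq_single_of_mem _ hmem]
  · simp
  · intro S _ hS
    rw [Fintype.prod_ite_zero, if_neg, mul_zero]
    intro h
    exact hS (by ext c; simp [h c])

variable {N : ℕ}

/-- The Vandermonde-type matrix whose first `a` rows are supported on the columns outside `S`,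
and whose last `N - a` rows are supported on the columns in `S`. -/
def blockVandermonde (e : ι ≃ Fin N) (a : ℕ) (γ : ι → R) (S : Finset ι) : Matrix ι ι R :=
  Matrix.of fun i c => if a ≤ (e i : ℕ) ↔ c ∈ S then
    γ c ^ (if (e i : ℕ) < a then (e i : ℕ) else (e i : ℕ) - a) else 0

theorem det_blockVandermonde_map {R' : Type*} [CommRing R'] (φ : R →+* R') (e : ι ≃ Fin N)
    (a : ℕ) (γ : ι → R) (S : Finset ι) :
    (blockVandermonde e a (fun c => φ (γ c)) S).det = φ (blockVandermonde e a γ S).det := by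
  rw [RingHom.map_det]
  congr 1
  ext i c
  simp [blockVandermonde, apply_ite φ]

/-- A block Vandermonde determinant, times the resultant of the nodes in `S` and the nodes
outside `S`, is the Vandermonde determinant. -/
theorem det_blockVandermonde_mul [Nontrivial R] (e : ι ≃ Fin N) (a : ℕ) (ha : a ≤ N) (γ : ι → R)
    (S : Finset ι) (hS : #S = N - a) :
    (blockVandermonde e a γ S).det * ∏ i ∈ S, ∏ j ∈ Sᶜ, (γ i - γ j) =
      (Matrix.vandermonde (γ ∘ e.symm)).det := by
  have hι : Fintype.card ι = N := by simpa using Fintype.card_congr e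
  have hSc : #Sᶜ = a := by rw [card_compl]; omega
  let Q : R[X] := ∏ j ∈ Sᶜ, (X - C (γ j))
  have hQ : Q.Monic := monic_prod_of_monic _ _ fun j _ => monic_X_sub_C _
  have hQd : Q.natDegree = a := by simp [Q, natDegree_prod_of_monic, monic_X_sub_C, hSc]
  let f : Fin N → R[X] := fun k => if (k : ℕ) < a then X ^ (k : ℕ) else X ^ ((k : ℕ) - a) * Q
  have hfm : ∀ k, (f k).Monic := by
    intro k
    simp only [f]
    split_ifs
    · exact monic_X_pow _
    · exact (monic_X_pow _).mul hQ
  have hfd : ∀ k, (f k).natDegree = k := by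
    intro k
    simp only [f]
    split_ifs
    · simp
    · rw [(monic_X_pow _).natDegree_mul hQ, hQd, natDegree_X_pow]
      omega
  have hf : (Matrix.vandermonde (γ ∘ e.symm)).det =
      (Matrix.of fun i c => (f (e i)).eval (γ c)).det := by
    rw [Matrix.det_eval_matrixOfPolynomials_eq_det_vandermonde _ f hfd hfm,
      ← Matrix.det_submatrix_equiv_self e, ← Matrix.det_transpose]
    congr 1
    ext i c
    simp
  rw [hf, det_eq_sum_det_mask (fun i => a ≤ (e i : ℕ)) (Matrix.of fun i c => _), card_filter_le_equiv,
    sum_eq_single_of_mem S (mem_powersetCard.2 ⟨subset_univ _, hS⟩)]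
  · have hv : ∏ i ∈ S, ∏ j ∈ Sᶜ, (γ i - γ j) = ∏ c, if c ∈ S then Q.eval (γ c) else 1 := by
      rw [prod_ite_mem, univ_inter]
      simp [Q, eval_prod]
    rw [hv, mul_comm, ← Matrix.det_mul_row]
    congr 1
    ext i c
    have hlt : a ≤ (e i : ℕ) ↔ ¬ (e i : ℕ) < a := not_lt.symm
    by_cases hc : c ∈ S <;> by_cases hi : (e i : ℕ) < a <;>
      simp [blockVandermonde, hc, hlt, hi, f, mul_comm]
  · intro S' hS' hne
    obtain ⟨c, hc', hc⟩ : ∃ c ∈ S', c ∉ S := by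
      by_contra! h
      exact hne (eq_of_subset_of_card_le h (by rw [hS, (mem_powersetCard.1 hS').2]))
    refine Matrix.det_eq_zero_of_column_eq_zero c fun i => ?_
    have hQc : Q.eval (γ c) = 0 := by
      simp only [Q, eval_prod]
      exact prod_eq_zero (mem_compl.2 hc) (by simp)
    have hlt : a ≤ (e i : ℕ) ↔ ¬ (e i : ℕ) < a := not_lt.symm
    by_cases hi : (e i : ℕ) < a <;> simp [hc', hlt, hi, f, hQc]

end LaplaceExpansion

section Sylvester

variable {R : Type*} [CommRing R] {m n : ℕ}

/-- The order on `Fin n ⊕ Fin m` placing `Fin n` before `Fin m`. -/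
def sumEquivFin (m n : ℕ) : Fin n ⊕ Fin m ≃ Fin (m + n) :=
  finSumFinEquiv.trans (finCongr (Nat.add_comm n m))

@[simp]
theorem sumEquivFin_inl (j : Fin n) : (sumEquivFin m n (Sum.inl j) : ℕ) = j := by
  simp [sumEquivFin]

@[simp]
theorem sumEquivFin_inr (i : Fin m) : (sumEquivFin m n (Sum.inr i) : ℕ) = n + i := by
  simp [sumEquivFin, add_comm]

theorem prod_Ioi_eq_prod_ite {ι : Type*} [Fintype ι] {N : ℕ} (e : ι ≃ Fin N) (F : ι → ι → R) :
    ∏ i, ∏ j ∈ Ioi i, F (e.symm i) (e.symm j) =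
      ∏ a, ∏ b, if (e a : ℕ) < e b then F a b else 1 := by
  rw [← e.prod_comp]
  refine prod_congr rfl fun a _ => ?_
  rw [← prod_filter]
  exact prod_equiv e.symm (by simp) (by simp)

theorem det_vandermonde_sumElim (A : Fin m → R) (B : Fin n → R) :
    (Matrix.vandermonde (Sum.elim B A ∘ (sumEquivFin m n).symm)).det =
      (Matrix.vandermonde A).det * (Matrix.vandermonde B).det * ∏ i, ∏ j, (A i - B j) := by
  have h₁ : ∀ (j : Fin n) (i : Fin m), (j : ℕ) < n + i := fun j i => by omega
  have h₂ : ∀ (j : Fin n) (i : Fin m), ¬ n + (i : ℕ) < j := fun j i => by omega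
  have hA : ∏ i, ∏ j ∈ Ioi i, (A j - A i) =
      ∏ i : Fin m, ∏ j : Fin m, if (i : ℕ) < j then A j - A i else 1 :=
    prod_Ioi_eq_prod_ite (Equiv.refl _) fun i j => A j - A i
  have hB : ∏ i, ∏ j ∈ Ioi i, (B j - B i) =
      ∏ i : Fin n, ∏ j : Fin n, if (i : ℕ) < j then B j - B i else 1 :=
    prod_Ioi_eq_prod_ite (Equiv.refl _) fun i j => B j - B i
  have hAB := prod_Ioi_eq_prod_ite (sumEquivFin m n) fun i j => Sum.elim B A j - Sum.elim B A i
  simp only [Matrix.det_vandermonde, Function.comp_apply, hA, hB, hAB, Fintype.prod_sum_type,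
    sumEquivFin_inl, sumEquivFin_inr, Sum.elim_inl, Sum.elim_inr, h₁, h₂, if_true, if_false,
    prod_const_one, prod_mul_distrib, add_lt_add_iff_left]
  rw [prod_comm (f := fun i j => A j - B i)]
  ring

theorem prod_prod_sub_swap {α β : Type*} (s : Finset α) (t : Finset β) (f : α → R) (g : β → R) :
    ∏ i ∈ s, ∏ j ∈ t, (f i - g j) = (-1) ^ (#s * #t) * ∏ j ∈ t, ∏ i ∈ s, (g j - f i) := by
  rw [prod_comm (s := t)]
  simp_rw [← neg_sub (g _) (f _), prod_neg, prod_mul_distrib]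
  simp [← pow_mul, mul_comm]

theorem compl_disjSum {α β : Type*} [Fintype α] [Fintype β] [DecidableEq α] [DecidableEq β]
    (s : Finset α) (t : Finset β) : (s.disjSum t)ᶜ = sᶜ.disjSum tᶜ := by
  ext (x | x) <;> simp

theorem det_blockVandermonde_sumElim_of_ne [IsDomain R] (A : Fin m → R) (B : Fin n → R)
    (hAB : ∀ i j, A i ≠ B j) (Sa : Finset (Fin m)) (Sb : Finset (Fin n)) :
    (blockVandermonde (sumEquivFin m n) (m + n - (#Sa + #Sb)) (Sum.elim B A)
        (Sb.disjSum Sa)).det *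
        ((∏ i ∈ Sa, ∏ i' ∈ Saᶜ, (A i - A i')) * ∏ j ∈ Sb, ∏ j' ∈ Sbᶜ, (B j - B j')) =
      (-1) ^ (#Sb * (m - #Sa)) *
        ((Matrix.vandermonde A).det * (Matrix.vandermonde B).det) *
        ((∏ i ∈ Sa, ∏ j ∈ Sb, (A i - B j)) * ∏ i ∈ Saᶜ, ∏ j ∈ Sbᶜ, (A i - B j)) := by
  have ha : #Sa ≤ m := card_finset_fin_le Sa
  have hb : #Sb ≤ n := card_finset_fin_le Sb
  have key := det_blockVandermonde_mul (sumEquivFin m n) (m + n - (#Sa + #Sb)) (Nat.sub_le _ _)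
    (Sum.elim B A) (Sb.disjSum Sa) (by rw [card_disjSum]; omega)
  have hprod : ∏ i, ∏ j, (A i - B j) =
      (∏ i ∈ Sa, ∏ j ∈ Sb, (A i - B j)) * (∏ i ∈ Sa, ∏ j ∈ Sbᶜ, (A i - B j)) *
      ((∏ i ∈ Saᶜ, ∏ j ∈ Sb, (A i - B j)) * ∏ i ∈ Saᶜ, ∏ j ∈ Sbᶜ, (A i - B j)) := by
    simp_rw [← prod_mul_distrib, prod_mul_prod_compl]
  rw [det_vandermonde_sumElim, hprod, compl_disjSum] at key
  simp only [prod_disjSum, Sum.elim_inl, Sum.elim_inr, prod_mul_distrib] at key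
  rw [prod_prod_sub_swap Sb Saᶜ B A, card_compl, Fintype.card_fin, prod_comm] at key
  have hne : (∏ i ∈ Sa, ∏ j ∈ Sbᶜ, (A i - B j)) * (∏ i ∈ Saᶜ, ∏ j ∈ Sb, (A i - B j)) ≠ 0 :=
    mul_ne_zero
      (prod_ne_zero_iff.2 fun i _ => prod_ne_zero_iff.2 fun j _ => sub_ne_zero.2 (hAB i j))
      (prod_ne_zero_iff.2 fun i _ => prod_ne_zero_iff.2 fun j _ => sub_ne_zero.2 (hAB i j))
  have hsign : ((-1 : R) ^ (#Sb * (m - #Sa))) * (-1) ^ (#Sb * (m - #Sa)) = 1 := by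
    rw [← mul_pow]; simp
  refine mul_right_cancel₀ hne ?_
  rw [prod_comm (s := Sb)]
  generalize (-1 : R) ^ (#Sb * (m - #Sa)) = ε at *
  linear_combination ε * key -
    (blockVandermonde (sumEquivFin m n) (m + n - (#Sa + #Sb)) (Sum.elim B A)
        (Sb.disjSum Sa)).det *
      ((∏ i ∈ Sa, ∏ i' ∈ Saᶜ, (A i - A i')) * ∏ j' ∈ Sbᶜ, ∏ j ∈ Sb, (B j - B j')) *
      ((∏ i ∈ Sa, ∏ j ∈ Sbᶜ, (A i - B j)) * ∏ i ∈ Saᶜ, ∏ j ∈ Sb, (A i - B j)) * hsign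

/-- The block Vandermonde determinant attached to subsets of `A` and `B`, up to the
denominators of Sylvester's double sum. -/
theorem det_blockVandermonde_sumElim [IsDomain R] (A : Fin m → R) (B : Fin n → R)
    (Sa : Finset (Fin m)) (Sb : Finset (Fin n)) :
    (blockVandermonde (sumEquivFin m n) (m + n - (#Sa + #Sb)) (Sum.elim B A)
        (Sb.disjSum Sa)).det *
        ((∏ i ∈ Sa, ∏ i' ∈ Saᶜ, (A i - A i')) * ∏ j ∈ Sb, ∏ j' ∈ Sbᶜ, (B j - B j')) =
      (-1) ^ (#Sb * (m - #Sa)) *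
        ((Matrix.vandermonde A).det * (Matrix.vandermonde B).det) *
        ((∏ i ∈ Sa, ∏ j ∈ Sb, (A i - B j)) * ∏ i ∈ Saᶜ, ∏ j ∈ Sbᶜ, (A i - B j)) := by
  have h := congrArg (evalRingHom (0 : R)) <| det_blockVandermonde_sumElim_of_ne
    (fun i => X + C (A i)) (fun j => C (B j))
    (fun i j hij => by simpa using congrArg (fun p => coeff p 1) hij) Sa Sb
  have hγ : (fun c => evalRingHom (0 : R)
      (Sum.elim (fun j => C (B j)) (fun i => X + C (A i)) c)) = Sum.elim B A := by
    ext (c | c) <;> simp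
  rw [map_mul, ← det_blockVandermonde_map, hγ] at h
  simpa [Matrix.det_vandermonde, eval_prod] using h

end Sylvester

theorem sylvU_submatrix_apply {m n : ℕ} (A : Fin m → K) (B : Fin n → K) (d : ℕ)
    (r c : Fin n ⊕ Fin m) :
    (sylvU A B d).submatrix (sumEquivFin m n) (sumEquivFin m n) r c =
      if (sumEquivFin m n r : ℕ) < m + n - d then
        Sum.elim (fun _ => 1) (fun _ => X) c *
          C (C (Sum.elim B A c ^ (sumEquivFin m n r : ℕ)))
      else C (C (Sum.elim B A c ^ ((sumEquivFin m n r : ℕ) - (m + n - d))) *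
        (X - C (Sum.elim B A c))) := by
  rcases c with c | c <;> simp [sylvU]

theorem det_mask_sylvU {m n : ℕ} (A : Fin m → K) (B : Fin n → K) (d : ℕ)
    (S : Finset (Fin n ⊕ Fin m)) :
    (Matrix.of fun r c => if m + n - d ≤ (sumEquivFin m n r : ℕ) ↔ c ∈ S then
        (sylvU A B d).submatrix (sumEquivFin m n) (sumEquivFin m n) r c else 0).det =
      C ((∏ c ∈ S, (X - C (Sum.elim B A c))) *
        C (blockVandermonde (sumEquivFin m n) (m + n - d) (Sum.elim B A) S).det) *
        X ^ #S.toRightᶜ := by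
  let v : Fin n ⊕ Fin m → K[X][X] := fun c =>
    if c ∈ S then C (X - C (Sum.elim B A c)) else Sum.elim (fun _ => 1) (fun _ => X) c
  have hv : ∏ c, v c = C (∏ c ∈ S, (X - C (Sum.elim B A c))) * X ^ #S.toRightᶜ := by
    rw [← prod_mul_prod_compl S, map_prod]
    congr 1
    · exact prod_congr rfl fun c hc => by simp [v, hc]
    · have hS : Sᶜ = S.toLeftᶜ.disjSum S.toRightᶜ := by ext (x | x) <;> simp
      rw [prod_congr rfl (g := Sum.elim (fun _ => 1) (fun _ => X))
        fun c hc => by simp [v, mem_compl.1 hc], hS]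
      simp
  rw [map_mul, mul_right_comm, ← hv, ← RingHom.comp_apply, ← det_blockVandermonde_map,
    ← Matrix.det_mul_row]
  congr 1
  ext1 r c
  simp only [Matrix.of_apply, sylvU_submatrix_apply]
  generalize m + n - d = a
  have hlt : a ≤ (sumEquivFin m n r : ℕ) ↔ ¬ (sumEquivFin m n r : ℕ) < a := not_lt.symm
  by_cases hc : c ∈ S <;> by_cases hr : (sumEquivFin m n r : ℕ) < a <;>
    simp [blockVandermonde, v, hc, hlt, hr, mul_comm]

theorem coeff_det_sylvU_eq_sum {m n : ℕ} (A : Fin m → K) (B : Fin n → K)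
    (d p : ℕ) (hd : d ≤ m + n) (hp : p ≤ m) (hpd : p ≤ d) :
    ((sylvU A B d).det).coeff (m - p) =
      ∑ Sa ∈ powersetCard p univ, ∑ Sb ∈ powersetCard (d - p) univ,
        (∏ i ∈ Sa, (X - C (A i))) * (∏ j ∈ Sb, (X - C (B j))) *
          C (blockVandermonde (sumEquivFin m n) (m + n - d) (Sum.elim B A)
            (Sb.disjSum Sa)).det := by
  rw [← Matrix.det_submatrix_equiv_self (sumEquivFin m n),
    det_eq_sum_det_mask (fun i => m + n - d ≤ (sumEquivFin m n i : ℕ)), card_filter_le_equiv,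
    Nat.sub_sub_self hd, finsetSum_coeff]
  simp_rw [det_mask_sylvU, coeff_C_mul_X_pow]
  rw [← sum_filter, ← sum_product']
  refine sum_nbij' (fun S => (S.toRight, S.toLeft)) (fun S => S.2.disjSum S.1) ?_ ?_ ?_ ?_ ?_
  · intro S hS
    have h₁ := card_finset_fin_le S.toRight
    have h₂ := S.card_toLeft_add_card_toRight
    simp only [mem_filter, mem_powersetCard, card_compl, Fintype.card_fin] at hS
    simp only [mem_product, mem_powersetCard, subset_univ, true_and]
    omega
  · rintro ⟨Sa, Sb⟩ hS
    simp only [mem_product, mem_powersetCard, subset_univ, true_and] at hS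
    simp only [mem_filter, mem_powersetCard, card_compl, Fintype.card_fin, subset_univ, true_and,
      toRight_disjSum, card_disjSum]
    omega
  · intro S _
    exact toLeft_disjSum_toRight
  · simp
  · intro S _
    rw [toLeft_disjSum_toRight, prod_sum_eq_prod_toLeft_mul_prod_toRight S]
    simp only [Sum.elim_inl, Sum.elim_inr]
    ring

/-- **Theorem 1 (matrix form)**: for `0 ≤ d ≤ m+n`, `0 ≤ p ≤ m` and `q := d - p` with
`0 ≤ q ≤ n`, the coefficient `u_{d,p}(x)` of `T^{m-p}` in `u_d(x,T) = det U_d(x,T)`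
equals `(-1)^{q(m-p)}·V(A)·V(B)·Sylv^{p,q}(A,B;x)`. -/
theorem coeff_det_sylvU {m n : ℕ} (hm : 1 ≤ m) (hn : 1 ≤ n) (hmn : m ≤ n)
    (A : Fin m → K) (B : Fin n → K) (hA : Function.Injective A) (hB : Function.Injective B)
    (d p : ℕ) (hd : d ≤ m + n) (hp : p ≤ m) (hpd : p ≤ d) (hq : d - p ≤ n) :
    ((sylvU A B d).det).coeff (m - p) =
      (-1 : Polynomial K) ^ ((d - p) * (m - p)) * C (vand A * vand B) *
        sylvSum A B p (d - p) := by
  rw [coeff_det_sylvU_eq_sum A B d p hd hp hpd, sylvSum]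
  simp_rw [mul_sum]
  refine sum_congr rfl fun Sa hSa => sum_congr rfl fun Sb hSb => ?_
  have ha := (mem_powersetCard.1 hSa).2
  have hb := (mem_powersetCard.1 hSb).2
  have key := det_blockVandermonde_sumElim A B Sa Sb
  rw [ha, hb, Nat.add_sub_cancel' hpd] at key
  have hne : (∏ i ∈ Sa, ∏ i' ∈ Saᶜ, (A i - A i')) * (∏ j ∈ Sb, ∏ j' ∈ Sbᶜ, (B j - B j')) ≠ 0 := by
    refine mul_ne_zero (prod_ne_zero_iff.2 fun i hi => prod_ne_zero_iff.2 fun j hj => ?_)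
      (prod_ne_zero_iff.2 fun i hi => prod_ne_zero_iff.2 fun j hj => ?_)
    · exact sub_ne_zero.2 fun h => mem_compl.1 hj (hA h ▸ hi)
    · exact sub_ne_zero.2 fun h => mem_compl.1 hj (hB h ▸ hi)
  rw [eq_div_of_mul_eq hne key, mul_div_assoc, Matrix.det_vandermonde, Matrix.det_vandermonde]
  simp only [vand, map_mul, map_pow, map_neg, map_one]
  ring
end

section
/- Let 0 ≤ d ≤ m+n and 0 ≤ p ≤ m, and suppose q := d−p satisfies q < 0 or q > n. Then u_{d,p}(x) = 0; that is, the coefficient of T^{m−p} in u_d(x,T) vanishes. -/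
open Polynomial Finset

variable {K : Type*} [Field K]

/-- If every entry of a square matrix is a monomial in `X` and no permutation has total exponent
`k`, then the coefficient of `X ^ k` in the determinant vanishes. -/
theorem coeff_det_eq_zero_of_monomial {R ι : Type*} [CommRing R] [Fintype ι] [DecidableEq ι]
    (M : Matrix ι ι (Polynomial R)) (a : ι → ι → R) (e : ι → ι → ℕ)
    (hM : ∀ i j, M i j = C (a i j) * X ^ e i j) (k : ℕ)
    (hk : ∀ σ : Equiv.Perm ι, ∑ j, e (σ j) j ≠ k) : M.det.coeff k = 0 := by
  rw [Matrix.det_apply, finsetSum_coeff]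
  refine Finset.sum_eq_zero fun σ _ => ?_
  simp only [hM, Finset.prod_mul_distrib, Finset.prod_pow_eq_pow_sum]
  rw [← map_prod, Units.smul_def, zsmul_eq_mul, ← map_intCast (C : R →+* R[X]), coeff_C_mul,
    coeff_C_mul_X_pow, if_neg (hk σ).symm, mul_zero]

/-- For a permutation of `Fin (m + n)`, the number `k` of the last `m` columns sent to the first
`m + n - d` rows satisfies `m ≤ d + k ≤ m + n`. -/
theorem card_filter_perm_bounds {m n d : ℕ} (hd : d ≤ m + n) (σ : Equiv.Perm (Fin (m + n))) :
    m ≤ d + #{j | (σ j : ℕ) < m + n - d ∧ n ≤ (j : ℕ)} ∧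
      d + #{j | (σ j : ℕ) < m + n - d ∧ n ≤ (j : ℕ)} ≤ m + n := by
  have hlt (a : ℕ) (ha : a ≤ m + n) : #{j : Fin (m + n) | (j : ℕ) < a} = a := by
    rw [Fin.card_filter_val_lt, min_eq_right ha]
  have hrow : #{j | (σ j : ℕ) < m + n - d} = m + n - d :=
    (Finset.card_equiv σ (by simp)).trans (hlt (m + n - d) (Nat.sub_le _ _))
  have hcol : #{j : Fin (m + n) | n ≤ (j : ℕ)} = m := by
    have h := Finset.card_filter_add_card_filter_not (s := (univ : Finset (Fin (m + n))))
      (fun j => (j : ℕ) < n)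
    simp only [not_lt, hlt n (Nat.le_add_left _ _), card_univ, Fintype.card_fin] at h
    omega
  have hle : #{j | (σ j : ℕ) < m + n - d ∧ n ≤ (j : ℕ)} ≤ #{j | (σ j : ℕ) < m + n - d} :=
    Finset.card_le_card fun j => by simp +contextual
  have hunion := Finset.card_union_add_card_inter
    ({j | (σ j : ℕ) < m + n - d} : Finset (Fin (m + n))) {j | n ≤ (j : ℕ)}
  rw [← Finset.filter_or, ← Finset.filter_and] at hunion
  have hcard := Finset.card_le_univ
    ({j | (σ j : ℕ) < m + n - d ∨ n ≤ (j : ℕ)} : Finset (Fin (m + n)))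
  rw [Fintype.card_fin] at hcard
  omega

/-- **Theorem 1 (vanishing part)**: for `0 ≤ d ≤ m+n` and `0 ≤ p ≤ m`, if `q := d - p`
satisfies `q < 0` or `q > n`, then the coefficient `u_{d,p}(x)` of `T^{m-p}` in
`u_d(x,T) = det U_d(x,T)` vanishes. -/
theorem coeff_det_sylvU_eq_zero {m n : ℕ} (hm : 1 ≤ m) (hn : 1 ≤ n) (hmn : m ≤ n)
    (A : Fin m → K) (B : Fin n → K) (hA : Function.Injective A) (hB : Function.Injective B)
    (d p : ℕ) (hd : d ≤ m + n) (hp : p ≤ m)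
    (hq : d < p ∨ n + p < d) :
    ((sylvU A B d).det).coeff (m - p) = 0 := by
  refine coeff_det_eq_zero_of_monomial _ (fun r c => (sylvU A B d r c).eval 1)
    (fun r c => if (r : ℕ) < m + n - d ∧ n ≤ (c : ℕ) then 1 else 0) (fun r c => ?_) _
    fun σ hσ => ?_
  · simp only [sylvU, Matrix.of_apply]
    by_cases hr : (r : ℕ) < m + n - d <;> by_cases hc : (c : ℕ) < n <;>
      simp [hr, hc, not_le.mpr, not_lt.mp, mul_comm]
  · have := card_filter_perm_bounds hd σ
    rw [← Finset.card_filter] at hσ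
    omega
end

section
/- The matrix U_d(x,T) factors as U_d(x,T) = L·N, where L is the (m+n)×(m+n+1) matrix whose first d' rows are [I_{d'} | 0] (identity block in the first d' columns) and whose last d rows are [0 | C], C being the d×(d+1) matrix with C_{i,i} = x, C_{i,i+1} = −1 and all other entries 0; and N is the (m+n+1)×(m+n) matrix whose first d' rows are [⟨1,B⟩_{d'} | ⟨T,A⟩_{d'}] and whose last d+1 rows are [⟨1,B⟩_{d+1} | ⟨1,A⟩_{d+1}]. -/
open Polynomial Finset

variable {K : Type*} [Field K]

/-- A row of a matrix product whose left factor is the unit vector at `i`. -/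
theorem sum_ite_val_eq_mul {R : Type*} [CommRing R] {N : ℕ} (i : Fin N)
    (f : Fin (N + 1) → R) :
    ∑ k : Fin (N + 1), (if (k : ℕ) = (i : ℕ) then (1 : R) else 0) * f k = f i.castSucc := by
  rw [Finset.sum_eq_single i.castSucc]
  · simp
  · intro k _ hk
    have : (k : ℕ) ≠ i := fun h => hk (Fin.ext h)
    simp [this]
  · simp

/-- A row of a matrix product whose left factor is the band `[a, -1]` starting at `i`. -/
theorem sum_band_mul {R : Type*} [CommRing R] {N : ℕ} (i : Fin N) (a : R)
    (f : Fin (N + 1) → R) :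
    ∑ k : Fin (N + 1),
        (if (k : ℕ) = (i : ℕ) then a else if (k : ℕ) = (i : ℕ) + 1 then -1 else 0) * f k =
      a * f i.castSucc - f i.succ := by
  rw [Finset.sum_eq_add_of_mem i.castSucc i.succ (Finset.mem_univ _) (Finset.mem_univ _)
    i.castSucc_lt_succ.ne]
  · simp [sub_eq_add_neg]
  · intro k _ hk
    have h₁ : (k : ℕ) ≠ i := fun h => hk.1 (Fin.ext h)
    have h₂ : (k : ℕ) ≠ i + 1 := fun h => hk.2 (Fin.ext h)
    simp [h₁, h₂]

/-- **The factorization `U_d(x,T) = L·N`** into an `(m+n)×(m+n+1)` matrix `L`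
(identity block and the `[x, -1]` band) and an `(m+n+1)×(m+n)` matrix `N`
(Vandermonde-type blocks). -/
theorem sylvU_factorization {m n : ℕ} (hm : 1 ≤ m) (hn : 1 ≤ n)
    (A : Fin m → K) (B : Fin n → K) (d : ℕ) (hd : d ≤ m + n) :
    sylvU A B d =
      (Matrix.of fun (r : Fin (m + n)) (c : Fin (m + n + 1)) =>
        if (r : ℕ) < m + n - d then
          (if (c : ℕ) = (r : ℕ) then (1 : Polynomial (Polynomial K)) else 0)
        else
          if (c : ℕ) = (r : ℕ) then C X
          else if (c : ℕ) = (r : ℕ) + 1 then -1 else 0) *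
      (Matrix.of fun (r : Fin (m + n + 1)) (c : Fin (m + n)) =>
        if (r : ℕ) < m + n - d then
          if h : (c : ℕ) < n then C (C (B ⟨c, h⟩ ^ (r : ℕ)))
          else X * C (C (A ⟨(c : ℕ) - n, by have := c.isLt; omega⟩ ^ (r : ℕ)))
        else
          if h : (c : ℕ) < n then C (C (B ⟨c, h⟩ ^ ((r : ℕ) - (m + n - d))))
          else C (C (A ⟨(c : ℕ) - n, by have := c.isLt; omega⟩ ^ ((r : ℕ) - (m + n - d))))) := by
  refine Matrix.ext fun r c => ?_
  rw [Matrix.mul_apply]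
  by_cases hr : (r : ℕ) < m + n - d
  · simp only [Matrix.of_apply, if_pos hr]
    rw [sum_ite_val_eq_mul r]
    simp [sylvU, hr]
  · simp only [Matrix.of_apply, if_neg hr]
    rw [sum_band_mul r]
    have hr' : ¬ (r : ℕ) + 1 < m + n - d := by omega
    have hs : (r : ℕ) + 1 - (m + n - d) = (r : ℕ) - (m + n - d) + 1 := by omega
    simp only [sylvU, Matrix.of_apply, Fin.val_castSucc, Fin.val_succ, if_neg hr, if_neg hr', hs]
    split_ifs <;> simp only [map_mul, map_sub, map_pow] <;> ring
end

section
/- If m < d < n−1, then u_d(x,T) = det U_d(x,T) = 0 identically as a polynomial in x and T. -/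
open Polynomial Finset

variable {K : Type*} [Field K]

/-- A left combination of the rows of a matrix whose column has top block `s * b ^ i` and bottom
block `b ^ i * y`, with coefficients taken from polynomials `P` and `Q`, is
`s * P(b) + Q(b) * y`. -/
theorem sum_coeff_mul_blocks {R : Type*} [CommRing R] (k d : ℕ) (P Q : Polynomial R)
    (hP : P.natDegree < k) (hQ : Q.natDegree < d) (s b y : R) :
    ∑ r ∈ Finset.range (k + d), (if r < k then P.coeff r else Q.coeff (r - k)) *
        (if r < k then s * b ^ r else b ^ (r - k) * y) =
      s * P.eval b + Q.eval b * y := by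
  rw [Finset.sum_range_add, eval_eq_sum_range' hP, eval_eq_sum_range' hQ, Finset.mul_sum,
    Finset.sum_mul]
  congr 1
  · refine Finset.sum_congr rfl fun r hr => ?_
    rw [if_pos (Finset.mem_range.mp hr), if_pos (Finset.mem_range.mp hr)]
    ring
  · refine Finset.sum_congr rfl fun r _ => ?_
    rw [if_neg (by omega), if_neg (by omega), Nat.add_sub_cancel_left]
    ring

/-- **Proposition (Sylvester, Arts. 23 & 24)**: if `m < d < n-1` then
`u_d(x,T) = det U_d(x,T) = 0` identically. -/
theorem det_sylvU_eq_zero {m n : ℕ} (hm : 1 ≤ m) (hn : 1 ≤ n) (hmn : m ≤ n)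
    (A : Fin m → K) (B : Fin n → K)
    (d : ℕ) (hd1 : m < d) (hd2 : d + 1 < n) :
    (sylvU A B d).det = 0 := by
  set F : Polynomial (Polynomial (Polynomial K)) := ∏ i, (X - C (C (C (A i)))) with hF
  set P : Polynomial (Polynomial (Polynomial K)) := (X - C (C X)) * F with hP
  have hFmonic : F.Monic := monic_prod_of_monic _ _ fun i _ => monic_X_sub_C _
  have hFdeg : F.natDegree = m := by
    rw [hF, natDegree_prod_of_monic _ _ fun i _ => monic_X_sub_C _]
    simp
  have hPdeg : P.natDegree = 1 + m := by
    rw [hP, (monic_X_sub_C _).natDegree_mul hFmonic, natDegree_X_sub_C, hFdeg]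
  have hFA : ∀ i, F.eval (C (C (A i))) = 0 := fun i => by
    rw [hF, eval_prod]
    exact Finset.prod_eq_zero (Finset.mem_univ i) (by simp)
  have hPeval : ∀ b, P.eval b = (b - C X) * F.eval b := fun b => by simp [hP]
  obtain ⟨k, hk⟩ : ∃ k, m + n - d = k := ⟨_, rfl⟩
  have hkd : m + n = k + d := by omega
  refine Matrix.exists_vecMul_eq_zero_iff.mp
    ⟨fun r => if (r : ℕ) < k then P.coeff r else F.coeff (r - k), fun h => ?_, ?_⟩
  · have h1 := congrFun h ⟨k + m, by omega⟩
    have h2 : F.coeff m = 1 := hFdeg ▸ hFmonic.coeff_natDegree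
    simp [h2] at h1
  · have key := sum_coeff_mul_blocks k d P F (by omega) (by omega)
    funext c
    rw [Pi.zero_apply, Matrix.vecMul, dotProduct]
    by_cases hc : (c : ℕ) < n
    · have hsum := key 1 (C (C (B ⟨c, hc⟩))) (C (X - C (B ⟨c, hc⟩)))
      rw [← hkd, ← Fin.sum_univ_eq_sum_range (fun r =>
        (if r < k then P.coeff r else F.coeff (r - k)) * _), hPeval] at hsum
      refine Eq.trans (Finset.sum_congr rfl fun r _ => ?_) (hsum.trans ?_)
      · simp [sylvU, hk, hc]
      · simp only [C_sub]
        ring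
    · set a := A ⟨(c : ℕ) - n, by have := c.isLt; omega⟩ with ha
      have hsum := key X (C (C a)) (C (X - C a))
      rw [← hkd, ← Fin.sum_univ_eq_sum_range (fun r =>
        (if r < k then P.coeff r else F.coeff (r - k)) * _), hPeval, ha, hFA] at hsum
      refine Eq.trans (Finset.sum_congr rfl fun r _ => ?_) (hsum.trans ?_)
      · simp [sylvU, hk, hc]
      · ring
end

section
/- Suppose 0 ≤ d ≤ m, with d < m if m = n or with the convention Δ_m(f,g) := 1 when d = m = n. Let M be the (m+n+1)-square matrix over K[T] whose first d' = m+n−d rows are [⟨1,B⟩_{d'} | ⟨T,A⟩_{d'} | 0] and whose last d+1 rows are [⟨1,B⟩_{d+1} | ⟨1,A⟩_{d+1} | e], where e is the (d+1)-column vector with a single entry 1 in the last position (position d+1). Then det M = (−1)^{dm} · V(A) · V(B) · Δ_d(f,g) · T^{m−d}(T−1)^d. -/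
open Polynomial Finset

variable {K : Type*} [Field K]

/-- If all columns of `M` but one consist of constants, then taking the `k`-th coefficient of
`det M` amounts to taking it in the remaining column. -/
theorem coeff_det_of_const_off_column {ι : Type*} [Fintype ι] [DecidableEq ι]
    (M : Matrix ι ι K[X]) (N : Matrix ι ι K) (c : ι) (k : ℕ)
    (h : ∀ i j, j ≠ c → M i j = C (N i j)) (hc : ∀ i, (M i c).coeff k = N i c) :
    M.det.coeff k = N.det := by
  have hM : M = (N.map C).updateCol c (fun i => M i c) := by
    ext1 i j
    by_cases hj : j = c
    · subst hj; simp
    · simp [Matrix.updateCol_ne hj, h i j hj]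
  have hN : N = N.updateCol c (fun i => N i c) := by simp
  have hadj : (N.map C).adjugate = N.adjugate.map C := (RingHom.map_adjugate C N).symm
  have hMdet := congrArg Matrix.det hM
  have hNdet := congrArg Matrix.det hN
  rw [← Matrix.cramer_apply, Matrix.cramer_eq_adjugate_mulVec] at hMdet hNdet
  rw [hMdet, hNdet, hadj]
  simp [Matrix.mulVec, dotProduct, hc]

/-- Evaluation of a polynomial of degree less than `N` as a sum over `Fin N`. -/
theorem sum_coeff_mul_pow {R : Type*} [CommRing R] {N : ℕ} {p : R[X]} (hp : p.natDegree < N)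
    (a : R) : ∑ s : Fin N, p.coeff s * a ^ (s : ℕ) = p.eval a := by
  rw [Fin.sum_univ_eq_sum_range (fun s => p.coeff s * a ^ s) N, eval_eq_sum_range' hp]

/-- The scalar subresultant as the determinant of a truncated Sylvester matrix, with rows and
columns ordered by increasing degree. -/
theorem sresDelta_eq_det (d e p : ℕ) (f g : K[X]) :
    sresDelta (d + e) (d + p) d f g =
      (Matrix.of fun i j : Fin (e + p) =>
        ((if (i : ℕ) < e then X ^ (i : ℕ) * g else X ^ ((i : ℕ) - e) * f : K[X])).coeff
          (d + j)).det := by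
  unfold sresDelta
  split_ifs with h
  · obtain rfl : e = 0 := by omega
    obtain rfl : p = 0 := by omega
    simp
  · have hpos : 0 < e + p := by omega
    unfold sres
    let φ : Fin (e + p) ≃ Fin ((d + p - d) + (d + e - d)) :=
      Fin.revPerm.trans (finCongr (by omega))
    have hφ : ∀ i, ((φ i : Fin _) : ℕ) = e + p - 1 - i := fun i => by
      simp [φ, Fin.val_rev]; omega
    rw [← Matrix.det_submatrix_equiv_self φ]
    apply coeff_det_of_const_off_column (c := ⟨0, hpos⟩)
    · intro i j hj
      have hj' : (j : ℕ) ≠ 0 := fun h => hj (Fin.ext h)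
      have hi := i.isLt
      have hjl := j.isLt
      simp only [sresMatGen, Matrix.submatrix_apply, Matrix.of_apply, hφ]
      by_cases hie : (i : ℕ) < e
      · rw [if_neg (by omega), if_neg (by omega), if_pos hie, coeff_X_pow_mul']
        split_ifs
        · congr 2; omega
        · omega
        · omega
        · simp
      · rw [if_pos (by omega), if_neg (by omega), if_neg hie, coeff_X_pow_mul']
        split_ifs
        · congr 2; omega
        · omega
        · omega
        · simp
    · intro i
      have hi := i.isLt
      simp only [sresMatGen, Matrix.submatrix_apply, Matrix.of_apply, hφ]
      by_cases hie : (i : ℕ) < e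
      · rw [if_neg (by omega), if_pos (by omega), if_pos hie]
        congr 3; omega
      · rw [if_pos (by omega), if_pos (by omega), if_neg hie]
        congr 3; omega

/-- The determinant of the matrix `[⟨1,A⟩_d ; ⟨g,A⟩_{m-d}]`, where `m = d + e`. -/
theorem det_evalRows_eq_vand_mul_sresDelta (d e p : ℕ) (A : Fin (d + e) → K) (f g : K[X])
    (hf : f.Monic) (hfd : f.natDegree = d + e) (hfA : ∀ i, f.eval (A i) = 0)
    (hg : g.Monic) (hgd : g.natDegree = d + p) :
    (Matrix.of fun i j : Fin (d + e) =>
      if (i : ℕ) < d then A j ^ (i : ℕ) else A j ^ ((i : ℕ) - d) * g.eval (A j)).det =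
      vand A * sresDelta (d + e) (d + p) d f g := by
  let P : ℕ → K[X] := fun r =>
    if r < d then X ^ r else if r < d + e then X ^ (r - d) * g else X ^ (r - (d + e)) * f
  have hPdeg : ∀ r < d + e + p, (P r).natDegree < d + e + p := by
    intro r hr
    simp only [P]
    split_ifs
    · simp; omega
    · rw [(monic_X_pow _).natDegree_mul hg, natDegree_X_pow]; omega
    · rw [(monic_X_pow _).natDegree_mul hf, natDegree_X_pow]; omega
  have hPf : ∀ i, P (d + e + i) = X ^ i * f := fun i => by
    simp only [P]
    rw [if_neg (by omega), if_neg (by omega), Nat.add_sub_cancel_left]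
  let S : Matrix (Fin (d + e + p)) (Fin (d + e + p)) K := Matrix.of fun r c => (P r).coeff c
  let V : Matrix (Fin (d + e + p)) (Fin (d + e + p)) K := Matrix.of fun r c =>
    if h : (c : ℕ) < d + e then A ⟨c, h⟩ ^ (r : ℕ) else if r = c then 1 else 0
  have hSV : (S * V).det = S.det * V.det := Matrix.det_mul S V
  have hV : V.det = vand A := by
    rw [← Matrix.det_submatrix_equiv_self finSumFinEquiv,
      ← Matrix.fromBlocks_toBlocks (V.submatrix _ _)]
    have h12 : (V.submatrix finSumFinEquiv finSumFinEquiv).toBlocks₁₂ = 0 := by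
      ext i j
      simp [V, Matrix.toBlocks₁₂, Fin.ext_iff]; omega
    have h22 : (V.submatrix finSumFinEquiv finSumFinEquiv).toBlocks₂₂ = 1 := by
      ext i j
      simp [V, Matrix.toBlocks₂₂, Matrix.one_apply, Fin.ext_iff]
    have h11 : (V.submatrix finSumFinEquiv finSumFinEquiv).toBlocks₁₁ =
        (Matrix.vandermonde A).transpose := by
      ext i j
      simp [V, Matrix.toBlocks₁₁, Matrix.vandermonde]
    rw [h12, Matrix.det_fromBlocks_zero₁₂, h22, h11, Matrix.det_transpose,
      Matrix.det_vandermonde, Matrix.det_one, mul_one, vand]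
  have hS : S.det = sresDelta (d + e) (d + p) d f g := by
    let φ : Fin d ⊕ Fin (e + p) ≃ Fin (d + e + p) :=
      finSumFinEquiv.trans (finCongr (by omega))
    rw [← Matrix.det_submatrix_equiv_self φ, ← Matrix.fromBlocks_toBlocks (S.submatrix _ _),
      sresDelta_eq_det]
    have h12 : (S.submatrix φ φ).toBlocks₁₂ = 0 := by
      ext i j
      simp [S, P, φ, Matrix.toBlocks₁₂, coeff_X_pow]; omega
    have h11 : (S.submatrix φ φ).toBlocks₁₁ = 1 := by
      ext i j
      simp [S, P, φ, Matrix.toBlocks₁₁, coeff_X_pow, Matrix.one_apply, Fin.ext_iff, eq_comm]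
    rw [h12, Matrix.det_fromBlocks_zero₁₂, h11, Matrix.det_one, one_mul]
    congr 1
    ext i j
    simp [S, P, φ, Matrix.toBlocks₂₂, Nat.add_sub_add_left]
  rw [← hV, ← hS, mul_comm, ← hSV]
  have hE : ∀ r c, (S * V) r c =
      if h : (c : ℕ) < d + e then (P r).eval (A ⟨c, h⟩) else (P r).coeff c := by
    intro r c
    simp only [Matrix.mul_apply, S, V, Matrix.of_apply]
    split_ifs with h
    · exact sum_coeff_mul_pow (hPdeg r r.isLt) _
    · simp
  rw [← Matrix.det_submatrix_equiv_self finSumFinEquiv (S * V),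
    ← Matrix.fromBlocks_toBlocks ((S * V).submatrix _ _)]
  have h21 : ((S * V).submatrix finSumFinEquiv finSumFinEquiv).toBlocks₂₁ = 0 := by
    ext i j
    simp [hE, hPf, Matrix.toBlocks₂₁, hfA]
  have h22 : (((S * V).submatrix finSumFinEquiv finSumFinEquiv).toBlocks₂₂).det = 1 := by
    rw [Matrix.det_of_isLowerTriangular]
    · apply Finset.prod_eq_one
      intro i _
      have : f.coeff (d + e) = 1 := hfd ▸ hf
      simp [hE, hPf, Matrix.toBlocks₂₂, coeff_X_pow_mul', this]
    · intro i j hij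
      have hij' : (i : ℕ) < j := hij
      have h0 : f.coeff (d + e + j - i) = 0 := coeff_eq_zero_of_natDegree_lt (by omega)
      simp [hE, hPf, Matrix.toBlocks₂₂, coeff_X_pow_mul', h0]
  rw [h21, Matrix.det_fromBlocks_zero₂₁, h22, mul_one]
  congr 1
  ext i j
  simp [hE, P, Matrix.toBlocks₁₁]
  split_ifs <;> simp

/-- The sign of interchanging the first `d` rows with the last `e` rows. -/
theorem det_swap_row_blocks {R : Type*} [CommRing R] (d e : ℕ)
    (M : Matrix (Fin (d + e)) (Fin (d + e)) R) :
    (Matrix.of fun i j : Fin (d + e) =>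
      if h : (i : ℕ) < e then M ⟨d + i, by omega⟩ j else M ⟨i - e, by omega⟩ j).det =
      (-1) ^ (d * (d + e - 1)) * M.det := by
  rcases Nat.eq_zero_or_pos (d + e) with h0 | h0
  · obtain rfl : d = 0 := by omega
    obtain rfl : e = 0 := by omega
    simp
  obtain ⟨k, hk⟩ : ∃ k, d + e = k + 1 := ⟨d + e - 1, by omega⟩
  have hval : ∀ (t : ℕ) (i : Fin (d + e)),
      (((finRotate (d + e)) ^ t) i : ℕ) = (t + i) % (d + e) := by
    rw [hk]
    intro t
    induction t with
    | zero => intro i; simp [Nat.mod_eq_of_lt i.isLt]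
    | succ t ih =>
      intro i
      rw [pow_succ', Equiv.Perm.mul_apply, finRotate_apply, Fin.val_add, ih, Fin.val_one',
        ← Nat.add_mod, add_right_comm]
  have hsign : Equiv.Perm.sign ((finRotate (d + e)) ^ d) = (-1) ^ (d * (d + e - 1)) := by
    rw [map_pow, sign_finRotate, ← pow_mul, mul_comm]
  have hsign' : ((Equiv.Perm.sign ((finRotate (d + e)) ^ d) : ℤ) : R) =
      (-1) ^ (d * (d + e - 1)) := by
    rw [hsign]; push_cast; rfl
  rw [← hsign', ← Matrix.det_permute]
  congr 1
  ext i j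
  simp only [Matrix.of_apply, Matrix.submatrix_apply, id]
  have hi := i.isLt
  split_ifs with h
  · congr 1
    apply Fin.ext
    rw [hval, Nat.mod_eq_of_lt (by omega)]
  · congr 1
    apply Fin.ext
    rw [hval, Nat.mod_eq_sub_mod (by omega), Nat.mod_eq_of_lt (by omega)]
    simp; omega

/-- Unitriangular row operations on a Vandermonde-like matrix whose first `d'` rows are scaled by
`u`: rows `n ≤ r < d'` become multiples of `g`, and the last `k` rows get the scale `1 - u`. -/
theorem det_two_scale_vandermonde {N k : ℕ} (d' n : ℕ) (hk : k + d' = N) (hkd : k ≤ d')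
    (hnd : n ≤ d') (a : Fin N → K) (u : Fin N → K[X]) (g : K[X]) (hg : g.Monic)
    (hgd : g.natDegree = n) :
    (Matrix.of fun r c : Fin N =>
      if (r : ℕ) < d' then u c * C (a c ^ (r : ℕ)) else C (a c ^ ((r : ℕ) - d'))).det =
    (Matrix.of fun r c : Fin N =>
      if (r : ℕ) < n then u c * C (a c ^ (r : ℕ))
      else if (r : ℕ) < d' then u c * C (a c ^ ((r : ℕ) - n) * g.eval (a c))
      else (1 - u c) * C (a c ^ ((r : ℕ) - d'))).det := by
  let P : ℕ → K[X] := fun r => if r < n then X ^ r else X ^ (r - n) * g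
  have hPdeg : ∀ r, (P r).natDegree = r := by
    intro r
    simp only [P]
    split_ifs
    · simp
    · rw [(monic_X_pow _).natDegree_mul hg, natDegree_X_pow]; omega
  have hPmonic : ∀ r, (P r).Monic := by
    intro r
    simp only [P]
    split_ifs
    · exact monic_X_pow _
    · exact (monic_X_pow _).mul hg
  set M : Matrix (Fin N) (Fin N) K[X] := Matrix.of fun r c : Fin N =>
      if (r : ℕ) < d' then u c * C (a c ^ (r : ℕ)) else C (a c ^ ((r : ℕ) - d')) with hM
  let L : Matrix (Fin N) (Fin N) K[X] := Matrix.of fun r s =>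
    if (r : ℕ) < d' then C ((P r).coeff s)
    else (if r = s then 1 else 0) - (if (s : ℕ) + d' = r then 1 else 0)
  have hL : L.det = 1 := by
    rw [Matrix.det_of_isLowerTriangular]
    · apply Finset.prod_eq_one
      intro r _
      simp only [L, Matrix.of_apply]
      split_ifs with h1 h2
      · have h := hPmonic r
        rw [Monic, leadingCoeff, hPdeg] at h
        rw [h, C_1]
      · have := r.isLt
        omega
      · simp
    · intro r s hrs
      have hrs' : (r : ℕ) < s := hrs
      simp only [L, Matrix.of_apply]
      split_ifs with h1 h2 h3 h3
      · rw [coeff_eq_zero_of_natDegree_lt (by rw [hPdeg]; exact hrs'), C_0]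
      · omega
      · exact absurd (congrArg Fin.val h2) (by omega)
      · omega
      · simp
  have hLM : M.det = (L * M).det := by rw [Matrix.det_mul, hL, one_mul]
  rw [hLM]
  congr 1
  ext1 r c
  have hr := r.isLt
  simp only [Matrix.mul_apply, Matrix.of_apply]
  by_cases hrd : (r : ℕ) < d'
  · have hsum : ∑ s, L r s * M s c = u c * C ((P r).eval (a c)) := by
      rw [← sum_coeff_mul_pow (N := N) (by rw [hPdeg]; exact hr), map_sum, Finset.mul_sum]
      refine Finset.sum_congr rfl fun s _ => ?_
      simp only [L, hM, Matrix.of_apply, if_pos hrd]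
      split_ifs with hs
      · rw [C_mul]; ring
      · rw [coeff_eq_zero_of_natDegree_lt (by rw [hPdeg]; omega)]; simp
    rw [hsum]
    simp only [P]
    split_ifs <;> simp
  · rw [if_neg (by omega), if_neg hrd]
    have hcond : ∀ s : Fin N, (s : ℕ) + d' = r ↔ (⟨r - d', by omega⟩ : Fin N) = s := by
      intro s
      rw [Fin.ext_iff]
      simp; omega
    simp only [L, Matrix.of_apply, if_neg hrd, hcond, sub_mul, Finset.sum_sub_distrib, ite_mul,
      one_mul, zero_mul, Finset.sum_ite_eq, Finset.mem_univ, if_true]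
    simp only [hM, Matrix.of_apply]
    rw [if_neg hrd, if_pos (by omega)]

/-- Expansion of `det (sylvM A B d d)` along its last column. -/
theorem det_sylvM_eq_det_minor {m n : ℕ} (A : Fin m → K) (B : Fin n → K) (d : ℕ)
    (hd : d ≤ m + n) :
    (sylvM A B d d).det =
      ((sylvM A B d d).submatrix Fin.castSucc Fin.castSucc).det := by
  rw [Matrix.det_succ_column _ (Fin.last _), Finset.sum_eq_single (Fin.last _)]
  · have hlast : sylvM A B d d (Fin.last _) (Fin.last _) = 1 := by
      simp only [sylvM, Matrix.of_apply, Fin.val_last]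
      rw [if_neg (by omega), dif_neg (by omega), dif_neg (by omega), if_pos (by omega)]
    rw [hlast, ← two_mul, pow_mul]
    simp [Fin.succAbove_last]
  · intro r _ hr
    have hr' : (r : ℕ) ≠ m + n := fun h => hr (Fin.ext h)
    have hrl := r.isLt
    have hz : sylvM A B d d r (Fin.last _) = 0 := by
      simp only [sylvM, Matrix.of_apply, Fin.val_last]
      split_ifs <;> first | omega | rfl
    rw [hz]
    simp
  · simp

/-- Separation of the powers of `T` and of `V(B)` in `det (sylvM A B d d)`. -/
theorem det_sylvM_eq_vand_mul {m n d : ℕ} (hdm : d ≤ m) (hmn : m ≤ n)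
    (A : Fin m → K) (B : Fin n → K) (g : K[X]) (hg : g.Monic) (hgd : g.natDegree = n)
    (hgB : ∀ j, g.eval (B j) = 0) :
    (sylvM A B d d).det = X ^ (m - d) * (1 - X) ^ d * C (vand B *
      (Matrix.of fun i j : Fin m => if (i : ℕ) < m - d then A j ^ (i : ℕ) * g.eval (A j)
        else A j ^ ((i : ℕ) - (m - d))).det) := by
  let a : Fin (m + n) → K := fun c =>
    if h : (c : ℕ) < n then B ⟨c, h⟩ else A ⟨(c : ℕ) - n, by omega⟩
  let u : Fin (m + n) → K[X] := fun c => if (c : ℕ) < n then 1 else X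
  have hminor : (sylvM A B d d).submatrix Fin.castSucc Fin.castSucc =
      Matrix.of fun r c : Fin (m + n) =>
        if (r : ℕ) < m + n - d then u c * C (a c ^ (r : ℕ))
        else C (a c ^ ((r : ℕ) - (m + n - d))) := by
    ext1 r c
    have hc := c.isLt
    simp only [sylvM, Matrix.submatrix_apply, Matrix.of_apply, Fin.val_castSucc, u, a]
    split_ifs <;> first | omega | simp
  rw [det_sylvM_eq_det_minor A B d (by omega), hminor,
    det_two_scale_vandermonde (k := d) (m + n - d) n (by omega) (by omega) (by omega) a u g hg hgd]
  let φ : Fin n ⊕ Fin m ≃ Fin (m + n) := finSumFinEquiv.trans (finCongr (add_comm n m))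
  have hl : ∀ j : Fin n, ((φ (Sum.inl j) : Fin _) : ℕ) = j := fun j => by simp [φ]
  have hr : ∀ j : Fin m, ((φ (Sum.inr j) : Fin _) : ℕ) = n + j := fun j => by
    simp [φ, add_comm]
  have hal : ∀ j, a (φ (Sum.inl j)) = B j := fun j => by simp [a, hl]
  have har : ∀ j, a (φ (Sum.inr j)) = A j := fun j => by simp [a, hr]
  have hul : ∀ j, u (φ (Sum.inl j)) = 1 := fun j => by simp [u, hl]
  have hur : ∀ j, u (φ (Sum.inr j)) = X := fun j => by simp [u, hr]
  have hcond : ∀ i : Fin m, n + (i : ℕ) < m + n - d ↔ (i : ℕ) < m - d := fun i => by omega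
  rw [← Matrix.det_submatrix_equiv_self φ, ← Matrix.fromBlocks_toBlocks (Matrix.submatrix _ φ φ)]
  set W := Matrix.submatrix (Matrix.of fun r c : Fin (m + n) =>
      if (r : ℕ) < n then u c * C (a c ^ (r : ℕ))
      else if (r : ℕ) < m + n - d then u c * C (a c ^ ((r : ℕ) - n) * g.eval (a c))
      else (1 - u c) * C (a c ^ ((r : ℕ) - (m + n - d)))) φ φ with hW
  have h21 : W.toBlocks₂₁ = 0 := by
    ext1 i j
    simp [hW, Matrix.toBlocks₂₁, hr, hal, hul, hgB]
  have h11 : W.toBlocks₁₁ = (Matrix.vandermonde B).transpose.map C := by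
    ext1 i j
    simp [hW, Matrix.toBlocks₁₁, hl, hal, hul, Matrix.vandermonde]
  have h22 : W.toBlocks₂₂ =
      Matrix.diagonal (fun i : Fin m => if (i : ℕ) < m - d then (X : K[X]) else 1 - X) *
        (Matrix.of fun i j : Fin m => if (i : ℕ) < m - d then A j ^ (i : ℕ) * g.eval (A j)
        else A j ^ ((i : ℕ) - (m - d))).map C := by
    ext1 i j
    have hi : n + (i : ℕ) - (m + n - d) = i - (m - d) := by omega
    simp only [hW, Matrix.toBlocks₂₂, hr, har, hur, hcond, hi, Matrix.diagonal_mul,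
      Matrix.map_apply, Matrix.of_apply, Matrix.submatrix_apply]
    rw [if_neg (by omega)]
    split_ifs <;> simp
  have hprod : ∏ i : Fin m, (if (i : ℕ) < m - d then (X : K[X]) else 1 - X) =
      X ^ (m - d) * (1 - X) ^ d := by
    rw [Fin.prod_univ_eq_prod_range (fun i => if i < m - d then (X : K[X]) else 1 - X) m,
      ← Nat.sub_add_cancel hdm, Finset.prod_range_add]
    simp +contextual [Finset.prod_congr]
  have hC : ∀ {k : ℕ} (Q : Matrix (Fin k) (Fin k) K), (Q.map C).det = C Q.det :=
    fun Q => (RingHom.map_det C Q).symm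
  rw [h21, Matrix.det_fromBlocks_zero₂₁, h11, h22, Matrix.det_mul, Matrix.det_diagonal, hprod,
    hC, hC, Matrix.det_transpose, Matrix.det_vandermonde, vand, C_mul]
  ring

/-- **Lemma 6, case `0 ≤ d ≤ m`** (with `d < m` if `m = n`, or the convention
`Δ_m(f,g) = 1` when `d = m = n`, built into `sresDelta`): the determinant of the
`(m+n+1)`-square matrix `M` equals `(-1)^{dm}·V(A)·V(B)·Δ_d(f,g)·T^{m-d}(T-1)^d`. -/
theorem det_sylvM_low {m n : ℕ} (hm : 1 ≤ m) (hn : 1 ≤ n) (hmn : m ≤ n)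
    (A : Fin m → K) (B : Fin n → K) (hA : Function.Injective A) (hB : Function.Injective B)
    (f g : Polynomial K) (hf : f = ∏ i, (X - C (A i))) (hg : g = ∏ j, (X - C (B j)))
    (d : ℕ) (hd : d ≤ m) :
    (sylvM A B d d).det =
      (-1 : Polynomial K) ^ (d * m) * C (vand A * vand B * sresDelta m n d f g) *
        X ^ (m - d) * (X - 1) ^ d := by
  have hfm : f.Monic := hf ▸ monic_prod_X_sub_C A _
  have hgm : g.Monic := hg ▸ monic_prod_X_sub_C B _
  have hfd : f.natDegree = m := by rw [hf, natDegree_finsetProd_X_sub_C_eq_card]; simp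
  have hgd : g.natDegree = n := by rw [hg, natDegree_finsetProd_X_sub_C_eq_card]; simp
  have hfA : ∀ i, f.eval (A i) = 0 := fun i => by
    rw [hf, eval_prod]
    exact Finset.prod_eq_zero (Finset.mem_univ i) (by simp)
  have hgB : ∀ j, g.eval (B j) = 0 := fun j => by
    rw [hg, eval_prod]
    exact Finset.prod_eq_zero (Finset.mem_univ j) (by simp)
  rw [det_sylvM_eq_vand_mul hd hmn A B g hgm hgd hgB]
  clear hf hg
  obtain ⟨e, rfl⟩ := Nat.exists_eq_add_of_le hd
  obtain ⟨p, rfl⟩ := Nat.exists_eq_add_of_le (hd.trans hmn)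
  have hrows := det_evalRows_eq_vand_mul_sresDelta d e p A f g hfm hfd hfA hgm hgd
  have hswap := det_swap_row_blocks d e (Matrix.of fun i j : Fin (d + e) =>
      if (i : ℕ) < d then A j ^ (i : ℕ) else A j ^ ((i : ℕ) - d) * g.eval (A j))
  rw [hrows] at hswap
  have hmat : (Matrix.of fun i j : Fin (d + e) => if (i : ℕ) < d + e - d
      then A j ^ (i : ℕ) * g.eval (A j) else A j ^ ((i : ℕ) - (d + e - d))).det =
      (-1) ^ (d * (d + e - 1)) * (vand A * sresDelta (d + e) (d + p) d f g) := by
    rw [← hswap]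
    congr 1
    ext i j
    have hi := i.isLt
    simp only [Matrix.of_apply, Nat.add_sub_cancel_left]
    split_ifs with h1 h2 h2
    · omega
    · simp
    · rfl
    · omega
  have hsign : (1 - X : K[X]) ^ d = (-1) ^ d * (X - 1) ^ d := by
    rw [← mul_pow]; congr 1; ring
  have hexp : (-1 : K[X]) ^ (d * (d + e)) = (-1) ^ (d * (d + e - 1)) * (-1) ^ d := by
    rw [← pow_add]; congr 1
    obtain ⟨k, hk⟩ := Nat.exists_eq_add_of_le' hm
    rw [hk, Nat.add_sub_cancel]; ring
  rw [hmat, hsign, hexp]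
  simp only [C_mul, C_pow, C_neg, C_1]
  ring
end

section
/- Suppose m < d = n−1 and set d' = m+n−d = m+1. Let M be the (m+n+1)-square matrix over K[T] whose first m+1 rows are [⟨1,B⟩_{m+1} | ⟨T,A⟩_{m+1} | 0] and whose last n = d+1 rows are [⟨1,B⟩_{n} | ⟨1,A⟩_{n} | e], where e is the n-column vector with a single entry 1 in position m+1. Then det M = (−1)^{m(d−1)+d} · V(A) · V(B) · (T−1)^m. -/
open Polynomial Finset

variable {K : Type*} [Field K]

theorem val_finRotate_pow (N k : ℕ) (i : Fin (N + 1)) :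
    (((finRotate (N + 1)) ^ k) i : ℕ) = (i + k) % (N + 1) := by
  induction k with
  | zero => simp [Nat.mod_eq_of_lt i.isLt]
  | succ k ih =>
    rw [pow_succ', Equiv.Perm.mul_apply, finRotate_apply, Fin.val_add, ih, Fin.val_one',
      ← Nat.add_mod, add_assoc]

theorem det_submatrix_finRotate_pow {R : Type*} [CommRing R] (N k : ℕ)
    (M : Matrix (Fin (N + 1)) (Fin (N + 1)) R) :
    (M.submatrix id ((finRotate (N + 1)) ^ k)).det = (-1) ^ (N * k) * M.det := by
  rw [Matrix.det_permute', map_pow, sign_finRotate, ← pow_mul]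
  simp

theorem det_transpose_vandermonde_C {u : ℕ} (Γ : Fin u → K) :
    (Matrix.of fun i j : Fin u => C (Γ j ^ (i : ℕ))).det = C (vand Γ) := by
  have h : (Matrix.of fun i j : Fin u => C (Γ j ^ (i : ℕ))) =
      (Matrix.vandermonde fun j => C (Γ j)).transpose := by
    ext1 i j
    simp [Matrix.vandermonde_apply]
  rw [h, Matrix.det_transpose, Matrix.det_vandermonde, vand]
  simp [map_prod]

/-- The block `[⟨T-1,A⟩_{m+1} | -e]`, where `e` is the last standard basis vector. -/
noncomputable def borderedBlock {m : ℕ} (A : Fin m → K) :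
    Matrix (Fin (m + 1)) (Fin (m + 1)) (Polynomial K) :=
  Matrix.of fun i j =>
    if h : (j : ℕ) < m then (X - 1) * C (A ⟨j, h⟩ ^ (i : ℕ))
    else if (i : ℕ) = m then -1 else 0

theorem det_borderedBlock {m : ℕ} (A : Fin m → K) :
    (borderedBlock A).det = -((X - 1) ^ m * C (vand A)) := by
  have h : (borderedBlock A).submatrix Fin.castSucc Fin.castSucc =
      (X - 1 : Polynomial K) • Matrix.of fun i j : Fin m => C (A j ^ (i : ℕ)) := by
    ext1 i j
    simp [borderedBlock]
  rw [Matrix.det_succ_column _ (Fin.last m), Finset.sum_eq_single (Fin.last m)]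
  · rw [Fin.succAbove_last, h, Matrix.det_smul, det_transpose_vandermonde_C]
    simp [borderedBlock, ← two_mul]
  · intro i _ hi
    have : (i : ℕ) ≠ m := fun h => hi (Fin.ext h)
    simp [borderedBlock, this]
  · simp

/-- The bottom right block `[⟨1,A⟩_n | e]`. -/
noncomputable def bottomBlock {m : ℕ} (A : Fin m → K) (n : ℕ) :
    Matrix (Fin n) (Fin (m + 1)) (Polynomial K) :=
  Matrix.of fun i j =>
    if h : (j : ℕ) < m then C (A ⟨j, h⟩ ^ (i : ℕ)) else if (i : ℕ) = m then 1 else 0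

theorem sylvM_rotate_eq_mul {m n : ℕ} (A : Fin m → K) (B : Fin n → K) (d : ℕ)
    (hd1 : m < d) (hd2 : d + 1 = n)
    (e : Fin (m + 1) ⊕ Fin n ≃ Fin (m + n + 1))
    (hel : ∀ i, (e (Sum.inl i) : ℕ) = i) (her : ∀ i, (e (Sum.inr i) : ℕ) = m + 1 + i) :
    ((sylvM A B d m).submatrix id ((finRotate (m + n + 1)) ^ n)).submatrix e e =
      Matrix.fromBlocks 1
          ((1 : Matrix (Fin n) (Fin n) (Polynomial K)).submatrix
            (Fin.castLE (by omega : m + 1 ≤ n)) id) 0 1 *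
        Matrix.fromBlocks (borderedBlock A) 0 (bottomBlock A n)
          (Matrix.of fun i j => C (B j ^ (i : ℕ))) := by
  have hmod1 : ∀ j : Fin (m + 1), ((j : ℕ) + n) % (m + n + 1) = j + n := fun j =>
    Nat.mod_eq_of_lt (by omega)
  have hmod2 : ∀ j : Fin n, (m + 1 + (j : ℕ) + n) % (m + n + 1) = j := fun j => by
    rw [show m + 1 + (j : ℕ) + n = j + (m + n + 1) by omega, Nat.add_mod_right]
    exact Nat.mod_eq_of_lt (by omega)
  have hN : m + n - d = m + 1 := by omega
  rw [Matrix.fromBlocks_multiply]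
  ext1 i j
  rcases i with i | i <;> rcases j with j | j
  · have hj : (j : ℕ) + n < n + m ↔ (j : ℕ) < m := by omega
    simp only [Matrix.submatrix_apply, Matrix.fromBlocks_apply₁₁, Matrix.one_mul,
      Matrix.add_apply, Matrix.mul_apply, Matrix.one_apply, ite_mul, one_mul, zero_mul,
      Finset.sum_ite_eq, Finset.mem_univ, if_true, id]
    simp only [sylvM, borderedBlock, bottomBlock, Matrix.of_apply, val_finRotate_pow, hel,
      hmod1, hN, i.isLt, if_true, hj, Nat.add_sub_cancel, Fin.val_castLE]
    rw [dif_neg (by omega)]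
    split_ifs <;> ring
  · simp [sylvM, Matrix.mul_apply, Matrix.one_apply, val_finRotate_pow, hel, her, hmod2, hN]
    exact fun h => absurd h (by omega)
  · have hj : (j : ℕ) + n < n + m ↔ (j : ℕ) < m := by omega
    simp [sylvM, bottomBlock, val_finRotate_pow, hel, her, hmod1, hN, hj]
    exact fun h => absurd h (by omega)
  · simp [sylvM, val_finRotate_pow, her, hmod2, hN]
    exact fun h => absurd h (by omega)

/-- **Lemma 6, case `m < d = n-1`**: the determinant of the `(m+n+1)`-square matrix `M`,
whose last column has its `1` in position `m+1` (0-based position `m` of the bottom block),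
equals `(-1)^{m(d-1)+d}·V(A)·V(B)·(T-1)^m`. -/
theorem det_sylvM_mid {m n : ℕ} (hm : 1 ≤ m) (hn : 1 ≤ n) (hmn : m ≤ n)
    (A : Fin m → K) (B : Fin n → K) (hA : Function.Injective A) (hB : Function.Injective B)
    (d : ℕ) (hd1 : m < d) (hd2 : d + 1 = n) :
    (sylvM A B d m).det =
      (-1 : Polynomial K) ^ (m * (d - 1) + d) * C (vand A * vand B) * (X - 1) ^ m := by
  let e : Fin (m + 1) ⊕ Fin n ≃ Fin (m + n + 1) :=
    finSumFinEquiv.trans (finCongr (by omega))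
  have h := congrArg Matrix.det (sylvM_rotate_eq_mul A B d hd1 hd2 e
    (fun i => by simp [e]) (fun i => by simp [e]))
  rw [Matrix.det_submatrix_equiv_self, det_submatrix_finRotate_pow, Matrix.det_mul,
    Matrix.det_fromBlocks_zero₂₁, Matrix.det_fromBlocks_zero₁₂, det_borderedBlock,
    det_transpose_vandermonde_C, Matrix.det_one, Matrix.det_one] at h
  have hsq : ((-1 : Polynomial K) ^ ((m + n) * n)) * (-1) ^ ((m + n) * n) = 1 := by
    rw [← mul_pow]; simp
  have hpar : (-1 : Polynomial K) ^ (m * (d - 1) + d) = -(-1) ^ ((m + n) * n) := by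
    obtain ⟨k, rfl⟩ : ∃ k, d = k + 1 := ⟨d - 1, by omega⟩
    subst hd2
    have hev : Even (m * k + (k + 1) + ((m + (k + 1 + 1)) * (k + 1 + 1) + 1)) := by
      have := Nat.even_mul_succ_self k
      obtain ⟨r, hr⟩ := this
      exact ⟨m * k + m + r + 2 * k + 3, by nlinarith⟩
    have h1 := hev.neg_one_pow (α := Polynomial K)
    rw [pow_add, pow_succ _ ((m + (k + 1 + 1)) * (k + 1 + 1))] at h1
    rw [Nat.add_sub_cancel]
    linear_combination (-(-1) ^ ((m + (k + 1 + 1)) * (k + 1 + 1))) * h1 -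
      (-1) ^ (m * k + (k + 1)) * hsq
  rw [hpar, C_mul]
  linear_combination (-1) ^ ((m + n) * n) * h - (sylvM A B d m).det * hsq
end

section
/- Suppose m ≤ n ≤ d < m+n and set d' = m+n−d (so 1 ≤ d' ≤ m; use the convention Δ_m(f,g) := 1 when d' = m = n). Let M be the (m+n+1)-square matrix over K[T] whose first d' rows are [⟨1,B⟩_{d'} | ⟨T,A⟩_{d'} | 0] and whose last d+1 rows are [⟨1,B⟩_{d+1} | ⟨1,A⟩_{d+1} | e], where e is the (d+1)-column vector with a single entry 1 in the last position. Then det M = (−1)^{d'n} · V(A) · V(B) · Δ_{d'}(f,g) · (T−1)^{d'}. -/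
open Polynomial Finset

variable {K : Type*} [Field K]

/-- Taking a coefficient commutes with the determinant when at most one column is
non-constant. -/
theorem coeff_det_of_col_eq_C {ι : Type*} [Fintype ι] [DecidableEq ι]
    (M : Matrix ι ι (Polynomial K)) (N : Matrix ι ι K) (c₀ : ι) (k : ℕ)
    (h : ∀ i c, c ≠ c₀ → M i c = C (N i c)) (h₀ : ∀ i, (M i c₀).coeff k = N i c₀) :
    M.det.coeff k = N.det := by
  rw [Matrix.det_apply, Matrix.det_apply, Polynomial.finsetSum_coeff]
  refine Finset.sum_congr rfl fun σ _ => ?_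
  rw [Polynomial.coeff_smul]
  congr 1
  rw [← Finset.mul_prod_erase _ _ (Finset.mem_univ c₀),
    ← Finset.mul_prod_erase _ (fun i => N (σ i) i) (Finset.mem_univ c₀),
    Finset.prod_congr rfl fun i hi => h (σ i) i (Finset.ne_of_mem_erase hi),
    ← map_prod, Polynomial.coeff_mul_C, h₀]

theorem sum_coeff_mul_pow_s17 {u v : ℕ} (p : Polynomial K) (x : K) (hp : p.natDegree < u + v) :
    ∑ i : Fin u, p.coeff i * x ^ (i : ℕ) + ∑ j : Fin v, p.coeff (u + j) * x ^ (u + (j : ℕ)) =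
      p.eval x := by
  rw [Polynomial.eval_eq_sum_range' hp, ← Fin.sum_univ_eq_sum_range (fun i => p.coeff i * x ^ i),
    Fin.sum_univ_add]
  simp

/-- The coefficients of `p, X p, …, X^(v-1) p` at `u, …, u+v-1` form a unitriangular matrix when
`p` is monic of degree `u`. -/
theorem det_coeff_X_pow_mul {u : ℕ} (v : ℕ) (p : Polynomial K) (hp : p.Monic)
    (hu : p.natDegree = u) :
    (Matrix.of fun i j : Fin v => (X ^ (i : ℕ) * p).coeff (u + j)).det = 1 := by
  rw [Matrix.det_of_isLowerTriangular]
  · refine Finset.prod_eq_one fun i _ => ?_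
    rw [Matrix.of_apply, add_comm, Polynomial.coeff_X_pow_mul', if_pos (by omega)]
    simpa [hu] using hp.coeff_natDegree
  · intro i j hij
    rw [Matrix.of_apply, Polynomial.coeff_X_pow_mul']
    split_ifs
    · have : (i : ℕ) < j := hij
      exact Polynomial.coeff_eq_zero_of_natDegree_lt (by omega)
    · rfl

/-- The interpolation matrix of `1, …, x^(k-1), g, x g, …, x^(l-1) g` at the points `a`. -/
noncomputable def evalMat {k l : ℕ} (a : Fin k ⊕ Fin l → K) (g : Polynomial K) :
    Matrix (Fin k ⊕ Fin l) (Fin k ⊕ Fin l) K :=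
  Matrix.of fun r c => Sum.elim (fun i : Fin k => a c ^ (i : ℕ))
    (fun j : Fin l => a c ^ (j : ℕ) * g.eval (a c)) r

/-- The coefficient matrix of `g, …, x^(l-1) g, f, …, x^(e-1) f` at `x^k, …, x^(k+l+e-1)`. -/
noncomputable def coeffMat (k l e : ℕ) (f g : Polynomial K) :
    Matrix (Fin l ⊕ Fin e) (Fin l ⊕ Fin e) K :=
  Matrix.of fun r c =>
    (Sum.elim (fun j : Fin l => X ^ (j : ℕ) * g) (fun i : Fin e => X ^ (i : ℕ) * f) r).coeff
      (k + Sum.elim (fun j : Fin l => (j : ℕ)) (fun i : Fin e => l + (i : ℕ)) c)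

theorem sresDelta_eq_det_s17 {k l e : ℕ} (hk : 0 < k) (f g : Polynomial K) :
    sresDelta (k + l) (k + e) k f g = (coeffMat k l e f g).det := by
  unfold sresDelta
  split_ifs with h
  · obtain rfl : l = 0 := by omega
    obtain rfl : e = 0 := by omega
    exact (Matrix.det_isEmpty).symm
  · let φ : Fin l ⊕ Fin e ≃ Fin ((k + e - k) + (k + l - k)) :=
      (finSumFinEquiv.trans Fin.revPerm).trans (finCongr (by omega))
    have hl : ∀ j : Fin l, (φ (Sum.inl j) : ℕ) = l + e - 1 - j := by
      intro j; simp [φ, Fin.val_rev]; omega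
    have hr : ∀ j : Fin e, (φ (Sum.inr j) : ℕ) = e - 1 - j := by
      intro j; simp [φ, Fin.val_rev]; omega
    rw [sres, ← Matrix.det_submatrix_equiv_self φ]
    refine coeff_det_of_col_eq_C _ _ (φ.symm ⟨(k + e - k) + (k + l - k) - 1, by omega⟩) k ?_ ?_
    · intro i c hc
      have hc' : (φ c : ℕ) ≠ (k + e - k) + (k + l - k) - 1 := by
        intro h'
        exact hc (by rw [Equiv.eq_symm_apply]; exact Fin.ext h')
      rcases i with i | i <;> rcases c with c | c <;>
      · simp only [sresMatGen, coeffMat, Matrix.submatrix_apply, Matrix.of_apply, Sum.elim_inl,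
          Sum.elim_inr, Polynomial.coeff_X_pow_mul', hl, hr] at hc' ⊢
        have := i.isLt
        have := c.isLt
        split_ifs <;> first | omega | rfl | (congr 2; omega) | simp
    · intro i
      generalize hc : φ.symm ⟨(k + e - k) + (k + l - k) - 1, by omega⟩ = c
      have hc' : (φ c : ℕ) = (k + e - k) + (k + l - k) - 1 := by
        rw [← hc, Equiv.apply_symm_apply]
      have hcz : Sum.elim (fun j : Fin l => (j : ℕ)) (fun i : Fin e => l + (i : ℕ)) c = 0 := by
        rcases c with c | c <;> simp only [hl, hr, Sum.elim_inl, Sum.elim_inr] at hc' ⊢ <;> omega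
      rcases i with i | i <;>
      · simp only [sresMatGen, coeffMat, Matrix.submatrix_apply, Matrix.of_apply, Sum.elim_inl,
          Sum.elim_inr, hl, hr, hcz, hc', if_true, add_zero]
        have := i.isLt
        split_ifs
        all_goals first | omega | (congr 3; omega)

/-- `det E = V(A) Δ_k(f,g)` for the interpolation matrix `E`. -/
theorem det_evalMat {k l : ℕ} (e : ℕ) (a : Fin k ⊕ Fin l → K) (f g : Polynomial K)
    (hf : f.Monic) (hfd : f.natDegree = k + l) (hfa : ∀ c, f.eval (a c) = 0)
    (hg : g.natDegree = k + e) :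
    (evalMat a g).det =
      (Matrix.of fun r c => a c ^ (finSumFinEquiv r : ℕ)).det * (coeffMat k l e f g).det := by
  let P : (Fin k ⊕ Fin l) → Polynomial K :=
    Sum.elim (fun i => X ^ (i : ℕ)) (fun j => X ^ (j : ℕ) * g)
  let V : Matrix (Fin k ⊕ Fin l) (Fin k ⊕ Fin l) K :=
    Matrix.of fun r c => a c ^ (finSumFinEquiv r : ℕ)
  let V' : Matrix (Fin e) (Fin k ⊕ Fin l) K := Matrix.of fun r c => a c ^ (k + l + (r : ℕ))
  let W₁₁ : Matrix (Fin k ⊕ Fin l) (Fin k ⊕ Fin l) K :=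
    Matrix.of fun r c => (P r).coeff (finSumFinEquiv c)
  let W₁₂ : Matrix (Fin k ⊕ Fin l) (Fin e) K := Matrix.of fun r c => (P r).coeff (k + l + c)
  let W₂₁ : Matrix (Fin e) (Fin k ⊕ Fin l) K :=
    Matrix.of fun r c => (X ^ (r : ℕ) * f).coeff (finSumFinEquiv c)
  let W₂₂ : Matrix (Fin e) (Fin e) K := Matrix.of fun r c => (X ^ (r : ℕ) * f).coeff (k + l + c)
  have hsum : ∀ (p : Polynomial K) (x : K), p.natDegree < k + l + e →
      ∑ i : Fin k ⊕ Fin l, p.coeff (finSumFinEquiv i) * x ^ (finSumFinEquiv i : ℕ) +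
        ∑ j : Fin e, p.coeff (k + l + j) * x ^ (k + l + (j : ℕ)) = p.eval x := by
    intro p x hp
    rw [← sum_coeff_mul_pow_s17 p x hp,
      Equiv.sum_comp finSumFinEquiv (fun i : Fin (k + l) => p.coeff i * x ^ (i : ℕ))]
  have hX : ∀ (p : Polynomial K) (i : ℕ), (X ^ i * p).natDegree ≤ i + p.natDegree :=
    fun p i => Polynomial.natDegree_mul_le.trans (by simp)
  have hP : ∀ r, (P r).natDegree < k + l + e := by
    rintro (r | r)
    · simp only [P, Sum.elim_inl, Polynomial.natDegree_X_pow]; omega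
    · simp only [P, Sum.elim_inr]; have := hX g r; omega
  have hmul : Matrix.fromBlocks W₁₁ W₁₂ W₂₁ W₂₂ * Matrix.fromBlocks V 0 V' 1 =
      Matrix.fromBlocks (evalMat a g) W₁₂ 0 W₂₂ := by
    rw [Matrix.fromBlocks_multiply]
    simp only [zero_add, mul_one, Matrix.mul_zero, Matrix.mul_one]
    congr 1
    · ext r c
      simp only [Matrix.add_apply, Matrix.mul_apply, W₁₁, W₁₂, V, V', Matrix.of_apply]
      rw [hsum _ _ (hP r)]
      rcases r with r | r <;> simp [P, evalMat]
    · ext r c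
      simp only [Matrix.add_apply, Matrix.mul_apply, W₂₁, W₂₂, V, V', Matrix.of_apply]
      rw [hsum _ _ (by have := hX f r; omega)]
      simp [hfa]
  have hW : (Matrix.fromBlocks W₁₁ W₁₂ W₂₁ W₂₂).det = (coeffMat k l e f g).det := by
    rw [← Matrix.det_submatrix_equiv_self (Equiv.sumAssoc (Fin k) (Fin l) (Fin e)).symm]
    have : (Matrix.fromBlocks W₁₁ W₁₂ W₂₁ W₂₂).submatrix
        (Equiv.sumAssoc (Fin k) (Fin l) (Fin e)).symm
        (Equiv.sumAssoc (Fin k) (Fin l) (Fin e)).symm =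
        Matrix.fromBlocks 1 0
          (Matrix.of fun r (c : Fin k) => (Sum.elim (fun j : Fin l => X ^ (j : ℕ) * g)
            (fun i : Fin e => X ^ (i : ℕ) * f) r).coeff c) (coeffMat k l e f g) := by
      ext (r | r | r) (c | c | c) <;>
        simp [W₁₁, W₁₂, W₂₁, W₂₂, P, coeffMat, Polynomial.coeff_X_pow, Matrix.one_apply,
          Fin.ext_iff, eq_comm, add_assoc] <;> omega
    rw [this, Matrix.det_fromBlocks_zero₁₂, Matrix.det_one, one_mul]
  have := congrArg Matrix.det hmul
  rw [Matrix.det_mul, hW, Matrix.det_fromBlocks_zero₁₂, Matrix.det_fromBlocks_zero₂₁,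
    Matrix.det_one, det_coeff_X_pow_mul e f hf hfd, mul_one, mul_one] at this
  rw [← this, mul_comm]

theorem det_vandermonde_blocks {n k l : ℕ} (hk : k ≤ n) (a : Fin k ⊕ Fin l → K) (b : Fin n → K)
    (g : Polynomial K) (hg : g.Monic) (hgd : g.natDegree = n) (hgb : ∀ j, g.eval (b j) = 0) :
    (Matrix.fromBlocks
      (Matrix.of fun i c : Fin n => C (b c ^ (i : ℕ)))
      (Matrix.of fun (i : Fin n) c => C (a c ^ (i : ℕ)))
      (Matrix.of fun (r : Fin k ⊕ Fin l) c =>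
        C (b c ^ Sum.elim (fun i : Fin k => (i : ℕ)) (fun j : Fin l => n + (j : ℕ)) r))
      (Matrix.of fun (r : Fin k ⊕ Fin l) c =>
        Sum.elim (fun i : Fin k => X * C (a c ^ (i : ℕ)))
          (fun j : Fin l => C (a c ^ (n + (j : ℕ)))) r)).det =
    C ((Matrix.of fun i c : Fin n => b c ^ (i : ℕ)).det * (evalMat a g).det) * (X - 1) ^ k := by
  let Q : Matrix (Fin k ⊕ Fin l) (Fin n) (Polynomial K) := Matrix.of fun r c =>
    Sum.elim (fun i : Fin k => if Fin.castLE hk i = c then -1 else 0)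
      (fun j : Fin l => C ((X ^ (j : ℕ) * g).coeff c)) r
  let W : Matrix (Fin l) (Fin l) K := Matrix.of fun i j => (X ^ (i : ℕ) * g).coeff (n + j)
  have hX : ∀ j : Fin l, (X ^ (j : ℕ) * g).natDegree < n + l := fun j => by
    have : (X ^ (j : ℕ) * g).natDegree ≤ j + g.natDegree :=
      Polynomial.natDegree_mul_le.trans (by simp)
    omega
  have hW : (W.map C).det = 1 := by
    have := RingHom.map_det (C : K →+* Polynomial K) W
    rw [det_coeff_X_pow_mul l g hg hgd, map_one] at this
    exact this.symm
  have hD : (Matrix.of fun (r : Fin k ⊕ Fin l) c =>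
        Sum.elim (fun i : Fin k => (X - 1) * C (a c ^ (i : ℕ)))
          (fun j : Fin l => C (a c ^ (j : ℕ) * g.eval (a c))) r) =
      Matrix.diagonal (Sum.elim (fun _ : Fin k => (X - 1 : Polynomial K)) (fun _ : Fin l => 1)) *
        (evalMat a g).map C := by
    ext1 r c
    rw [Matrix.diagonal_mul]
    rcases r with r | r <;> simp [evalMat]
  have hmul : Matrix.fromBlocks 1 0 Q (Matrix.fromBlocks 1 0 0 (W.map C)) * Matrix.fromBlocks
      (Matrix.of fun i c : Fin n => C (b c ^ (i : ℕ)))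
      (Matrix.of fun (i : Fin n) c => C (a c ^ (i : ℕ)))
      (Matrix.of fun (r : Fin k ⊕ Fin l) c =>
        C (b c ^ Sum.elim (fun i : Fin k => (i : ℕ)) (fun j : Fin l => n + (j : ℕ)) r))
      (Matrix.of fun (r : Fin k ⊕ Fin l) c =>
        Sum.elim (fun i : Fin k => X * C (a c ^ (i : ℕ)))
          (fun j : Fin l => C (a c ^ (n + (j : ℕ)))) r) =
      Matrix.fromBlocks ((Matrix.of fun i c : Fin n => b c ^ (i : ℕ)).map C)
        (Matrix.of fun (i : Fin n) c => C (a c ^ (i : ℕ))) 0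
        (Matrix.of fun (r : Fin k ⊕ Fin l) c =>
          Sum.elim (fun i : Fin k => (X - 1) * C (a c ^ (i : ℕ)))
            (fun j : Fin l => C (a c ^ (j : ℕ) * g.eval (a c))) r) := by
    rw [Matrix.fromBlocks_multiply]
    simp only [Matrix.one_mul, Matrix.zero_mul, add_zero]
    congr 1
    · ext1 (r | r) c
      · simp [Matrix.mul_apply, Q, Matrix.one_apply]
      · simp only [Matrix.add_apply, Matrix.mul_apply, Q, W, Matrix.of_apply, Sum.elim_inr,
          Fintype.sum_sum_type, Matrix.fromBlocks_apply₂₁, Matrix.fromBlocks_apply₂₂,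
          Matrix.zero_apply, zero_mul, Finset.sum_const_zero, zero_add, Matrix.map_apply,
          ← map_mul, ← map_sum, ← map_add]
        rw [sum_coeff_mul_pow_s17 _ _ (hX r)]
        simp [hgb]
    · ext1 (r | r) c
      · simp [Matrix.mul_apply, Q, Matrix.one_apply]
        ring
      · simp only [Matrix.add_apply, Matrix.mul_apply, Q, W, Matrix.of_apply, Sum.elim_inr,
          Fintype.sum_sum_type, Matrix.fromBlocks_apply₂₁, Matrix.fromBlocks_apply₂₂,
          Matrix.zero_apply, zero_mul, Finset.sum_const_zero, zero_add, Matrix.map_apply,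
          ← map_mul, ← map_sum, ← map_add]
        rw [sum_coeff_mul_pow_s17 _ _ (hX r)]
        simp
  have hdet := congrArg Matrix.det hmul
  rw [Matrix.det_mul, Matrix.det_fromBlocks_zero₁₂, Matrix.det_fromBlocks_zero₁₂, hW,
    Matrix.det_one, Matrix.det_one, one_mul, one_mul, one_mul, Matrix.det_fromBlocks_zero₂₁, hD,
    Matrix.det_mul, Matrix.det_diagonal] at hdet
  rw [hdet, map_mul, RingHom.map_det, RingHom.map_det]
  simp only [RingHom.mapMatrix_apply, Fintype.prod_sum_type, Sum.elim_inl, Sum.elim_inr,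
    Finset.prod_const, Finset.card_univ, Fintype.card_fin, one_pow, mul_one]
  ring

/-- The block rotation of `0, …, n + k + r - 1` that moves the first `n` elements past the
next `k`. -/
def blockRot (n k r : ℕ) : Equiv.Perm (Fin (n + k + r)) where
  toFun i := if h : (i : ℕ) < n then ⟨i + k, by omega⟩
    else if h' : (i : ℕ) < n + k then ⟨i - n, by omega⟩ else i
  invFun i := if h : (i : ℕ) < k then ⟨i + n, by omega⟩
    else if h' : (i : ℕ) < n + k then ⟨i - k, by omega⟩ else i
  left_inv i := by
    apply Fin.ext
    by_cases h : (i : ℕ) < n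
    · simp [h]
    · by_cases h' : (i : ℕ) < n + k
      · simp [h, h']; split_ifs <;> simp <;> omega
      · simp [h, h']; split_ifs
        · simp; omega
        · rfl
  right_inv i := by
    apply Fin.ext
    by_cases h : (i : ℕ) < k
    · simp [h]; split_ifs; simp; omega
    · by_cases h' : (i : ℕ) < n + k
      · simp [h, h']; split_ifs <;> simp <;> omega
      · simp [h, h']; split_ifs
        · simp; omega
        · rfl

theorem blockRot_val (n k r : ℕ) (i : Fin (n + k + r)) :
    (blockRot n k r i : ℕ) =
      if (i : ℕ) < n then i + k else if (i : ℕ) < n + k then i - n else i := by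
  simp only [blockRot, Equiv.coe_fn_mk]
  split_ifs <;> rfl

theorem sign_blockRot (n k r : ℕ) : Equiv.Perm.sign (blockRot n k r) = (-1) ^ (k * n) := by
  rw [Equiv.Perm.sign_eq_prod_prod_Iio]
  have h : ∀ j : Fin (n + k + r), (∏ i ∈ Finset.Iio j,
      if blockRot n k r i < blockRot n k r j then (1 : ℤˣ) else -1) =
      if n ≤ (j : ℕ) ∧ (j : ℕ) < n + k then (-1) ^ n else 1 := by
    intro j
    split_ifs with hj
    · have : ∀ i ∈ Finset.Iio j, (if blockRot n k r i < blockRot n k r j then (1 : ℤˣ) else -1) =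
          if (i : ℕ) < n then -1 else 1 := by
        intro i hi
        rw [Finset.mem_Iio, Fin.lt_def] at hi
        simp only [Fin.lt_def, blockRot_val]
        split_ifs <;> first | rfl | omega
      rw [Finset.prod_congr rfl this, Finset.prod_subset (Finset.subset_univ _),
        Fin.prod_univ_add, Fin.prod_univ_add]
      · simp [add_assoc]
      · intro i _ hi
        rw [Finset.mem_Iio, Fin.lt_def] at hi
        rw [if_neg (by omega)]
    · refine Finset.prod_eq_one fun i hi => if_pos ?_
      rw [Finset.mem_Iio, Fin.lt_def] at hi
      simp only [Fin.lt_def, blockRot_val]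
      split_ifs <;> omega
  rw [Finset.prod_congr rfl fun j _ => h j, Fin.prod_univ_add, Fin.prod_univ_add]
  have h1 : ∀ i : Fin n, ¬ (n ≤ (i : ℕ)) := fun i => by omega
  simp [h1, mul_comm k n, pow_mul]

theorem vand_eq_det {u : ℕ} (Γ : Fin u → K) :
    vand Γ = (Matrix.of fun i j : Fin u => Γ j ^ (i : ℕ)).det := by
  rw [vand, ← Matrix.det_vandermonde, ← Matrix.det_transpose]
  rfl

/-- The order-preserving enumeration of consecutive blocks of sizes `n`, `k`, `l` and `1`. -/
def blockEquiv (n k l : ℕ) : (Fin n ⊕ (Fin k ⊕ Fin l)) ⊕ Fin 1 ≃ Fin (n + k + (l + 1)) :=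
  (((Equiv.sumAssoc _ _ _).symm.sumCongr (Equiv.refl _)).trans (Equiv.sumAssoc _ _ _)).trans
    ((finSumFinEquiv.sumCongr finSumFinEquiv).trans finSumFinEquiv)

theorem blockEquiv_inl_inl (n k l : ℕ) (i : Fin n) :
    (blockEquiv n k l (Sum.inl (Sum.inl i)) : ℕ) = i := by
  simp [blockEquiv]

theorem blockEquiv_inl_inr_inl (n k l : ℕ) (i : Fin k) :
    (blockEquiv n k l (Sum.inl (Sum.inr (Sum.inl i))) : ℕ) = n + i := by
  simp [blockEquiv]

theorem blockEquiv_inl_inr_inr (n k l : ℕ) (i : Fin l) :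
    (blockEquiv n k l (Sum.inl (Sum.inr (Sum.inr i))) : ℕ) = n + k + i := by
  simp [blockEquiv]

theorem blockEquiv_inr (n k l : ℕ) (i : Fin 1) :
    (blockEquiv n k l (Sum.inr i) : ℕ) = n + k + l := by
  simp [blockEquiv]

theorem sylvM_apply_left {m n : ℕ} (A : Fin m → K) (B : Fin n → K) (d e₀ : ℕ)
    (r c : Fin (m + n + 1)) (j : Fin n) (hc : (c : ℕ) = j) :
    sylvM A B d e₀ r c = if (r : ℕ) < m + n - d then C (B j ^ (r : ℕ))
      else C (B j ^ ((r : ℕ) - (m + n - d))) := by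
  have h : (c : ℕ) < n := hc ▸ j.isLt
  obtain rfl : ⟨c, h⟩ = j := Fin.ext hc
  simp only [sylvM, Matrix.of_apply, dif_pos h]

theorem sylvM_apply_middle {m n : ℕ} (A : Fin m → K) (B : Fin n → K) (d e₀ : ℕ)
    (r c : Fin (m + n + 1)) (i : Fin m) (hc : (c : ℕ) = n + i) :
    sylvM A B d e₀ r c = if (r : ℕ) < m + n - d then X * C (A i ^ (r : ℕ))
      else C (A i ^ ((r : ℕ) - (m + n - d))) := by
  have h : ¬ (c : ℕ) < n := by omega
  have h' : (c : ℕ) < n + m := by omega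
  have hi : ⟨(c : ℕ) - n, by omega⟩ = i := Fin.ext (by simp; omega)
  simp only [sylvM, Matrix.of_apply, dif_neg h, dif_pos h', hi]

theorem sylvM_apply_last {m n : ℕ} (A : Fin m → K) (B : Fin n → K) (d e₀ : ℕ)
    (r c : Fin (m + n + 1)) (hc : (c : ℕ) = n + m) :
    sylvM A B d e₀ r c = if (r : ℕ) < m + n - d then 0
      else if (r : ℕ) - (m + n - d) = e₀ then 1 else 0 := by
  have h : ¬ (c : ℕ) < n := by omega
  have h' : ¬ (c : ℕ) < n + m := by omega
  simp only [sylvM, Matrix.of_apply, dif_neg h, dif_neg h']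

theorem sylvM_submatrix_blockRot {k l e : ℕ} (A : Fin (k + l) → K) (B : Fin (k + e) → K) (d : ℕ)
    (hdm : d ≤ k + l + (k + e)) (hk : k = k + l + (k + e) - d)
    (hN : (k + e) + k + (l + 1) = k + l + (k + e) + 1) :
    ((((sylvM A B d d).submatrix (finCongr hN) (finCongr hN)).submatrix
      (blockRot (k + e) k (l + 1)) id).submatrix
        (blockEquiv (k + e) k l) (blockEquiv (k + e) k l)) =
      Matrix.fromBlocks (Matrix.fromBlocks
        (Matrix.of fun i c : Fin (k + e) => C (B c ^ (i : ℕ)))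
        (Matrix.of fun (i : Fin (k + e)) c => C (A (finSumFinEquiv c) ^ (i : ℕ)))
        (Matrix.of fun (r : Fin k ⊕ Fin l) c =>
          C (B c ^ Sum.elim (fun i : Fin k => (i : ℕ)) (fun j : Fin l => k + e + (j : ℕ)) r))
        (Matrix.of fun (r : Fin k ⊕ Fin l) c =>
          Sum.elim (fun i : Fin k => X * C (A (finSumFinEquiv c) ^ (i : ℕ)))
            (fun j : Fin l => C (A (finSumFinEquiv c) ^ (k + e + (j : ℕ)))) r)) 0
        (Matrix.of fun r c => sylvM A B d d (finCongr hN (blockRot (k + e) k (l + 1)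
          (blockEquiv (k + e) k l (Sum.inr r)))) (finCongr hN (blockEquiv (k + e) k l (Sum.inl c))))
        1 := by
  have h₁ : ∀ i : Fin (k + e), (blockRot (k + e) k (l + 1)
      (blockEquiv (k + e) k l (Sum.inl (Sum.inl i))) : ℕ) = i + k := fun i => by
    rw [blockRot_val, blockEquiv_inl_inl, if_pos i.isLt]
  have h₂ : ∀ i : Fin k, (blockRot (k + e) k (l + 1)
      (blockEquiv (k + e) k l (Sum.inl (Sum.inr (Sum.inl i)))) : ℕ) = i := fun i => by
    rw [blockRot_val, blockEquiv_inl_inr_inl, if_neg (by omega), if_pos (by omega)]; omega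
  have h₃ : ∀ i : Fin l, (blockRot (k + e) k (l + 1)
      (blockEquiv (k + e) k l (Sum.inl (Sum.inr (Sum.inr i)))) : ℕ) = k + e + k + i := fun i => by
    rw [blockRot_val, blockEquiv_inl_inr_inr, if_neg (by omega), if_neg (by omega)]
  have h₄ : ∀ i : Fin 1, (blockRot (k + e) k (l + 1)
      (blockEquiv (k + e) k l (Sum.inr i)) : ℕ) = k + e + k + l := fun i => by
    rw [blockRot_val, blockEquiv_inr, if_neg (by omega), if_neg (by omega)]
  ext1 (r | r) (c | c)
  · rw [Matrix.fromBlocks_apply₁₁, Matrix.submatrix_apply, Matrix.submatrix_apply,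
      Matrix.submatrix_apply]
    rcases c with c | c
    · rw [sylvM_apply_left A B d d _ _ c (by simp [blockEquiv_inl_inl])]
      rcases r with r | r | r <;>
        simp only [finCongr_apply, Fin.val_cast, h₁, h₂, h₃, ← hk, Matrix.fromBlocks_apply₁₁,
          Matrix.fromBlocks_apply₂₁, Matrix.of_apply, Sum.elim_inl, Sum.elim_inr] <;>
        split_ifs <;> first | omega | rfl | (congr 2; omega)
    · rw [sylvM_apply_middle A B d d _ _ (finSumFinEquiv c) (by
        rcases c with c | c <;> simp [blockEquiv_inl_inr_inl, blockEquiv_inl_inr_inr, add_assoc])]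
      rcases r with r | r | r <;>
        simp only [finCongr_apply, Fin.val_cast, h₁, h₂, h₃, ← hk, Matrix.fromBlocks_apply₁₂,
          Matrix.fromBlocks_apply₂₂, Matrix.of_apply, Sum.elim_inl, Sum.elim_inr] <;>
        split_ifs <;> first | omega | rfl | (congr 2; omega)
  · rw [Matrix.fromBlocks_apply₁₂, Matrix.submatrix_apply, Matrix.submatrix_apply,
      Matrix.submatrix_apply,
      sylvM_apply_last A B d d _ _ (by simp [blockEquiv_inr, add_assoc])]
    rcases r with r | r | r <;> simp only [finCongr_apply, Fin.val_cast, h₁, h₂, h₃, ← hk,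
        Matrix.zero_apply] <;>
      split_ifs <;> first | omega | rfl
  · rfl
  · rw [Matrix.fromBlocks_apply₂₂, Matrix.submatrix_apply, Matrix.submatrix_apply,
      Matrix.submatrix_apply,
      sylvM_apply_last A B d d _ _ (by simp [blockEquiv_inr, add_assoc]),
      Subsingleton.elim r c, Matrix.one_apply_eq, finCongr_apply, Fin.val_cast, h₄, ← hk,
      if_neg (by omega), if_pos (by omega)]

/-- **Lemma 6, case `m ≤ n ≤ d < m+n`**: with `d' := m+n-d` (and the convention
`Δ_m(f,g) = 1` when `d' = m = n`, built into `sresDelta`), the determinant of the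
`(m+n+1)`-square matrix `M` equals `(-1)^{d'n}·V(A)·V(B)·Δ_{d'}(f,g)·(T-1)^{d'}`. -/
theorem det_sylvM_high {m n : ℕ} (hm : 1 ≤ m) (hn : 1 ≤ n) (hmn : m ≤ n)
    (A : Fin m → K) (B : Fin n → K) (hA : Function.Injective A) (hB : Function.Injective B)
    (f g : Polynomial K) (hf : f = ∏ i, (X - C (A i))) (hg : g = ∏ j, (X - C (B j)))
    (d : ℕ) (hnd : n ≤ d) (hdm : d < m + n) :
    (sylvM A B d d).det =
      (-1 : Polynomial K) ^ ((m + n - d) * n) *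
        C (vand A * vand B * sresDelta m n (m + n - d) f g) * (X - 1) ^ (m + n - d) := by
  obtain ⟨k, hk⟩ : ∃ k, k = m + n - d := ⟨_, rfl⟩
  obtain ⟨l, rfl⟩ : ∃ l, m = k + l := ⟨m - k, by omega⟩
  obtain ⟨e, rfl⟩ : ∃ e, n = k + e := ⟨n - k, by omega⟩
  rw [← hk]
  have hfm : f.Monic := hf ▸ Polynomial.monic_prod_X_sub_C A _
  have hgm : g.Monic := hg ▸ Polynomial.monic_prod_X_sub_C B _
  have hfd : f.natDegree = k + l := by
    rw [hf, Polynomial.natDegree_finsetProd_X_sub_C_eq_card]; simp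
  have hgd : g.natDegree = k + e := by
    rw [hg, Polynomial.natDegree_finsetProd_X_sub_C_eq_card]; simp
  have hfA : ∀ i, f.eval (A i) = 0 := fun i => by
    rw [hf, Polynomial.eval_prod]
    exact Finset.prod_eq_zero (Finset.mem_univ i) (by simp)
  have hgB : ∀ i, g.eval (B i) = 0 := fun i => by
    rw [hg, Polynomial.eval_prod]
    exact Finset.prod_eq_zero (Finset.mem_univ i) (by simp)
  have hN : (k + e) + k + (l + 1) = k + l + (k + e) + 1 := by omega
  let M := (sylvM A B d d).submatrix (finCongr hN) (finCongr hN)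
  have hM : (M.submatrix (blockRot (k + e) k (l + 1)) id).det =
      (-1) ^ (k * (k + e)) * (sylvM A B d d).det := by
    rw [Matrix.det_permute, sign_blockRot, Matrix.det_submatrix_equiv_self]
    simp
  rw [← Matrix.det_submatrix_equiv_self (blockEquiv (k + e) k l),
    sylvM_submatrix_blockRot A B d hdm.le hk hN, Matrix.det_fromBlocks_zero₁₂, Matrix.det_one,
    mul_one, det_vandermonde_blocks (by omega) _ B g hgm hgd hgB,
    det_evalMat e _ f g hfm hfd (fun c => hfA _) hgd, ← vand_eq_det] at hM
  have hV : vand A =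
      (Matrix.of fun r c => A (finSumFinEquiv c) ^ (finSumFinEquiv r : ℕ) :
        Matrix (Fin k ⊕ Fin l) (Fin k ⊕ Fin l) K).det := by
    rw [vand_eq_det, ← Matrix.det_submatrix_equiv_self finSumFinEquiv]
    rfl
  rw [← hV, ← sresDelta_eq_det_s17 (by omega)] at hM
  have hs : ((-1 : Polynomial K) ^ (k * (k + e))) * (-1) ^ (k * (k + e)) = 1 := by
    rw [← mul_pow]; simp
  rw [mul_assoc, show vand A * vand B * sresDelta (k + l) (k + e) k f g =
    vand B * (vand A * sresDelta (k + l) (k + e) k f g) by ring, hM, ← mul_assoc, hs, one_mul]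
end
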